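/- arXiv:1804.06232 — 4 statements merged into one kernel-verified Lean document; each statement's English description precedes it below -/
import Mathlib

section
/- Let ω be a smooth, closed, nondegenerate 2-form (a symplectic form) on a neighborhood of 0 in ℝ^{2n}, let A be a real (2n)×(2n) matrix, and let S(x) = Ax be the corresponding linear vector field. Assume L_S ω = ω near 0. Then there exists a local diffeomorphism φ of ℝ^{2n} with φ(0) = 0 and Dφ(0) = id such that: (a) φ*ω is the constant 2-form ω₀ equal to the value ω(0); and (b) φ preserves S: Dφ(x)(Ax) = A·φ(x) for all x near 0. -/
open scoped Topology

section SmoothFlow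

open scoped ContDiff unitInterval
open Set Filter MeasureTheory

universe u

namespace ContinuousMap

section Topological

variable {K : Type*} [TopologicalSpace K]

open Classical in
/-- The superposition operator `γ ↦ f ∘ γ`, with value `0` where `f ∘ γ` is not continuous. -/
noncomputable def superpose {E F : Type*} [TopologicalSpace E] [TopologicalSpace F] [Zero F]
    (f : E → F) (γ : C(K, E)) : C(K, F) :=
  if h : Continuous (f ∘ γ) then ⟨f ∘ γ, h⟩ else 0

theorem superpose_apply {E F : Type*} [TopologicalSpace E] [TopologicalSpace F] [Zero F]
    {f : E → F} {W : Set E} (hf : ContinuousOn f W) {γ : C(K, E)} (hγ : ∀ k, γ k ∈ W) (k : K) :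
    superpose f γ k = f (γ k) := by
  have h : Continuous (f ∘ γ) := hf.comp_continuous γ.continuous hγ
  simp [superpose, h]

theorem isOpen_setOf_forall_mem [CompactSpace K] {E : Type*} [TopologicalSpace E]
    {W : Set E} (hW : IsOpen W) : IsOpen {γ : C(K, E) | ∀ k, γ k ∈ W} := by
  simpa [MapsTo] using isOpen_setOfPred_mapsTo (X := K) isCompact_univ hW

end Topological

variable {K : Type*} [TopologicalSpace K] [CompactSpace K]

theorem continuousOn_superpose [LocallyCompactSpace K] {E F : Type*} [NormedAddCommGroup E]
    [NormedAddCommGroup F] {f : E → F} {W : Set E} (hW : IsOpen W) (hf : ContinuousOn f W) :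
    ContinuousOn (superpose (K := K) f) {γ | ∀ k, γ k ∈ W} := by
  intro γ hγ
  apply ContinuousAt.continuousWithinAt
  rw [ContinuousAt, Metric.tendsto_nhds]
  intro ε hε
  have key : ∀ᶠ γ' in 𝓝 γ, ∀ k ∈ (univ : Set K), dist (f (γ' k)) (f (γ k)) < ε := by
    refine isCompact_univ.eventually_forall_of_forall_eventually fun k _ ↦ ?_
    have hc : ContinuousAt f (γ k) := hf.continuousAt (hW.mem_nhds (hγ k))
    have h1 : Tendsto (fun z : C(K, E) × K ↦ f (z.1 z.2)) (𝓝 (γ, k)) (𝓝 (f (γ k))) :=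
      hc.tendsto.comp (f := fun z : C(K, E) × K ↦ z.1 z.2)
        (by simpa using (continuous_eval (F := C(K, E))).tendsto (γ, k))
    have h2 : Tendsto (fun z : C(K, E) × K ↦ f (γ z.2)) (𝓝 (γ, k)) (𝓝 (f (γ k))) :=
      hc.tendsto.comp (f := fun z : C(K, E) × K ↦ γ z.2)
        ((γ.continuous.comp continuous_snd).tendsto (γ, k))
    have h3 := h1.dist h2
    rw [dist_self] at h3
    exact h3.eventually (gt_mem_nhds hε)
  filter_upwards [key, (isOpen_setOf_forall_mem hW).mem_nhds hγ] with γ' h1 h2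
  rw [dist_lt_iff hε]
  intro k
  rw [superpose_apply hf h2, superpose_apply hf hγ]
  exact h1 k trivial

variable {E F : Type*} [NormedAddCommGroup E] [NormedSpace ℝ E]
  [NormedAddCommGroup F] [NormedSpace ℝ F]

/-- Pointwise application of a continuous family of operators to a continuous family of vectors. -/
noncomputable def pointwiseApply : C(K, E →L[ℝ] F) →L[ℝ] C(K, E) →L[ℝ] C(K, F) :=
  LinearMap.mkContinuous₂
    (LinearMap.mk₂ ℝ (fun (L : C(K, E →L[ℝ] F)) (h : C(K, E)) ↦
        (⟨fun k ↦ L k (h k), L.continuous.clm_apply h.continuous⟩ : C(K, F)))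
      (fun _ _ _ ↦ by ext; simp) (fun _ _ _ ↦ by ext; simp)
      (fun _ _ _ ↦ by ext; simp) (fun _ _ _ ↦ by ext; simp)) 1 fun L h ↦ by
    rw [one_mul, ContinuousMap.norm_le _ (by positivity)]
    exact fun k ↦ (L k).le_of_opNorm_le_of_le (L.norm_coe_le_norm k) (h.norm_coe_le_norm k)

@[simp]
theorem pointwiseApply_apply (L : C(K, E →L[ℝ] F)) (h : C(K, E)) (k : K) :
    pointwiseApply L h k = L k (h k) := rfl

variable [LocallyCompactSpace K]

theorem hasFDerivAt_superpose {f : E → F} {W : Set E} (hW : IsOpen W) (hf : ContDiffOn ℝ 1 f W)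
    {γ : C(K, E)} (hγ : ∀ k, γ k ∈ W) :
    HasFDerivAt (superpose (K := K) f) (pointwiseApply (superpose (fderiv ℝ f) γ)) γ := by
  have hf' : ContinuousOn (fderiv ℝ f) W := hf.continuousOn_fderiv_of_isOpen hW le_rfl
  rw [hasFDerivAt_iff_isLittleO, Asymptotics.isLittleO_iff]
  intro ε hε
  have key : ∀ᶠ γ' in 𝓝 γ, ∀ k ∈ (univ : Set K),
      ‖f (γ' k) - f (γ k) - fderiv ℝ f (γ k) (γ' k - γ k)‖ ≤ ε * ‖γ' k - γ k‖ := by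
    refine isCompact_univ.eventually_forall_of_forall_eventually fun k₀ _ ↦ ?_
    have hW' := hW.mem_nhds (hγ k₀)
    have hs := (hf.contDiffAt hW').hasStrictFDerivAt one_ne_zero
    have h0 : Tendsto (fun z : C(K, E) × K ↦ γ z.2) (𝓝 (γ, k₀)) (𝓝 (γ k₀)) :=
      (γ.continuous.comp continuous_snd).tendsto (γ, k₀)
    have h1 : Tendsto (fun z : C(K, E) × K ↦ (z.1 z.2, γ z.2)) (𝓝 (γ, k₀))
        (𝓝 (γ k₀, γ k₀)) :=
      Tendsto.prodMk_nhds (by simpa using (continuous_eval (F := C(K, E))).tendsto (γ, k₀)) h0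
    have h2 := h1.eventually (hs.isLittleO.def (half_pos hε))
    have h3 : ∀ᶠ z : C(K, E) × K in 𝓝 (γ, k₀),
        ‖fderiv ℝ f (γ z.2) - fderiv ℝ f (γ k₀)‖ < ε / 2 := by
      have := (hf'.continuousAt hW').tendsto.comp h0
      have := Metric.tendsto_nhds.1 this (ε / 2) (half_pos hε)
      simpa [dist_eq_norm] using this
    filter_upwards [h2, h3] with z hz2 hz3
    calc _ = ‖(f (z.1 z.2) - f (γ z.2) - fderiv ℝ f (γ k₀) (z.1 z.2 - γ z.2)) -
            (fderiv ℝ f (γ z.2) - fderiv ℝ f (γ k₀)) (z.1 z.2 - γ z.2)‖ := by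
          rw [_root_.sub_apply]; congr 1; abel
      _ ≤ ε / 2 * ‖z.1 z.2 - γ z.2‖ + ε / 2 * ‖z.1 z.2 - γ z.2‖ :=
          (norm_sub_le _ _).trans (add_le_add hz2 (ContinuousLinearMap.le_of_opNorm_le _ hz3.le _))
      _ = _ := by ring
  filter_upwards [key, (isOpen_setOf_forall_mem hW).mem_nhds hγ] with γ' h1 h2
  rw [norm_le _ (by positivity)]
  intro k
  simp only [sub_apply, pointwiseApply_apply, superpose_apply hf.continuousOn h2,
    superpose_apply hf.continuousOn hγ, superpose_apply hf' hγ]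
  refine (h1 k trivial).trans ?_
  gcongr
  exact (γ' - γ).norm_coe_le_norm k

end ContinuousMap

theorem ContDiffOn.superpose_nat {K : Type*} [TopologicalSpace K] [CompactSpace K]
    [LocallyCompactSpace K] {E : Type u} [NormedAddCommGroup E] [NormedSpace ℝ E]
    {W : Set E} (hW : IsOpen W) (n : ℕ) :
    ∀ {F : Type u} [NormedAddCommGroup F] [NormedSpace ℝ F] {f : E → F}, ContDiffOn ℝ n f W →
      ContDiffOn ℝ n (ContinuousMap.superpose (K := K) f) {γ | ∀ k, γ k ∈ W} := by
  induction n with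
  | zero =>
    intro F _ _ f hf
    exact contDiffOn_zero.2 (ContinuousMap.continuousOn_superpose hW (contDiffOn_zero.1 hf))
  | succ n ih =>
    intro F _ _ f hf
    have hd (γ : C(K, E)) (hγ : ∀ k, γ k ∈ W) :=
      ContinuousMap.hasFDerivAt_superpose hW (hf.of_le (by exact_mod_cast Nat.le_add_left 1 n)) hγ
    have hf' : ContDiffOn ℝ n (fderiv ℝ f) W :=
      ((contDiffOn_succ_iff_fderiv_of_isOpen hW).1 (by exact_mod_cast hf)).2.2
    push_cast
    rw [contDiffOn_succ_iff_fderiv_of_isOpen (ContinuousMap.isOpen_setOf_forall_mem hW)]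
    refine ⟨fun γ hγ ↦ (hd γ hγ).differentiableAt.differentiableWithinAt, by simp, ?_⟩
    have h := ContDiff.comp_contDiffOn (n := n)
      (ContinuousMap.pointwiseApply (K := K) (E := E) (F := F)).contDiff (ih hf')
    exact h.congr fun γ hγ ↦ (hd γ hγ).fderiv

theorem ContDiffOn.superpose {K : Type*} [TopologicalSpace K] [CompactSpace K]
    [LocallyCompactSpace K] {E F : Type u} [NormedAddCommGroup E] [NormedSpace ℝ E]
    [NormedAddCommGroup F] [NormedSpace ℝ F] {W : Set E} (hW : IsOpen W) {f : E → F}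
    (hf : ContDiffOn ℝ ∞ f W) :
    ContDiffOn ℝ ∞ (ContinuousMap.superpose (K := K) f) {γ | ∀ k, γ k ∈ W} :=
  contDiffOn_infty.2 fun n ↦ ContDiffOn.superpose_nat hW n (contDiffOn_infty.1 hf n)

/-- The primitive vanishing at `0`, as an operator on continuous functions on `[0, 1]`. -/
noncomputable def ContinuousMap.primitive {E : Type*} [NormedAddCommGroup E] [NormedSpace ℝ E] :
    C(I, E) →L[ℝ] C(I, E) :=
  LinearMap.mkContinuous
    { toFun g := ⟨fun t ↦ ∫ s in (0 : ℝ)..t, Set.IccExtend zero_le_one g s,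
        (intervalIntegral.continuous_primitive
          (fun _ _ ↦ (g.continuous.Icc_extend' (h := zero_le_one)).intervalIntegrable _ _) 0).comp
          continuous_subtype_val⟩
      map_add' g h := by
        ext t
        exact intervalIntegral.integral_add
          ((g.continuous.Icc_extend' (h := zero_le_one)).intervalIntegrable _ _)
          ((h.continuous.Icc_extend' (h := zero_le_one)).intervalIntegrable _ _)
      map_smul' c g := by
        ext t
        exact intervalIntegral.integral_smul c _ } 1 fun g ↦ by
    rw [one_mul, ContinuousMap.norm_le _ (norm_nonneg g)]
    intro t
    have h := intervalIntegral.norm_integral_le_of_norm_le_const (a := (0 : ℝ)) (b := t)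
      (f := Set.IccExtend zero_le_one g) (C := ‖g‖) fun s _ ↦ g.norm_coe_le_norm _
    refine h.trans (mul_le_of_le_one_right (norm_nonneg g) ?_)
    rw [sub_zero, abs_of_nonneg t.2.1]
    exact t.2.2

theorem ContinuousMap.primitive_apply {E : Type*} [NormedAddCommGroup E] [NormedSpace ℝ E]
    (g : C(I, E)) (t : I) :
    primitive g t = ∫ s in (0 : ℝ)..t, Set.IccExtend zero_le_one g s := rfl

/-- A path satisfies `c = u + ∫ g` if and only if it starts at `u` and has derivative `g`. -/
theorem ContinuousMap.eq_const_add_primitive_iff {E : Type*} [NormedAddCommGroup E]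
    [NormedSpace ℝ E] [CompleteSpace E] {c g : C(I, E)} {u : E} :
    c = const I u + primitive g ↔ c 0 = u ∧ ∀ t : I,
      HasDerivWithinAt (Set.IccExtend zero_le_one c) (g t) (Icc (0 : ℝ) 1) t := by
  have hg : Continuous (Set.IccExtend zero_le_one g) := g.continuous.Icc_extend'
  constructor
  · intro h
    refine ⟨by rw [h]; simp [primitive_apply], fun t ↦ ?_⟩
    have h1 : HasDerivAt
        (fun x : ℝ ↦ u + ∫ s in (0 : ℝ)..x, Set.IccExtend zero_le_one g s) (g t) t := by
      simpa using (hg.integral_hasStrictDerivAt 0 (t : ℝ)).hasDerivAt.const_add u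
    refine h1.hasDerivWithinAt.congr_of_mem (fun x hx ↦ ?_) t.2
    rw [IccExtend_of_mem _ _ hx, h]
    simp [primitive_apply]
  · rintro ⟨h0, h⟩
    ext t
    have h1 : ∫ s in (0 : ℝ)..t, Set.IccExtend zero_le_one g s =
        Set.IccExtend zero_le_one c t - Set.IccExtend zero_le_one c 0 := by
      refine intervalIntegral.integral_eq_sub_of_hasDeriv_right
        c.continuous.Icc_extend'.continuousOn (fun x hx ↦ ?_) (hg.intervalIntegrable _ _)
      rw [min_eq_left t.2.1, max_eq_right t.2.1] at hx
      have hx' : x ∈ Icc (0 : ℝ) 1 := ⟨hx.1.le, hx.2.le.trans t.2.2⟩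
      rw [IccExtend_of_mem _ _ hx']
      exact ((h ⟨x, hx'⟩).hasDerivAt (Icc_mem_nhds hx.1 (hx.2.trans_le t.2.2))).hasDerivWithinAt
    simp [primitive_apply, h1, ← h0]

/-- The inverse function theorem for smooth functions, with a smooth inverse on an open set. -/
theorem ContDiffOn.exists_smooth_localInverse {E F : Type*} [NormedAddCommGroup E] [NormedSpace ℝ E]
    [CompleteSpace E] [NormedAddCommGroup F] [NormedSpace ℝ F] {f : E → F} {s : Set E}
    (hs : IsOpen s) {a : E} (ha : a ∈ s) (hf : ContDiffOn ℝ ∞ f s)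
    (hinv : (fderiv ℝ f a).IsInvertible) :
    ∃ t ⊆ s, IsOpen t ∧ a ∈ t ∧ IsOpen (f '' t) ∧ (∀ x ∈ t, (fderiv ℝ f x).IsInvertible) ∧
      ∃ g : F → E, ContDiffOn ℝ ∞ g (f '' t) ∧ ∀ x ∈ t, g (f x) = x := by
  have hfa := hf.contDiffAt (hs.mem_nhds ha)
  have hder {x} (hx : x ∈ s) : HasFDerivAt f (fderiv ℝ f x) x :=
    ((hf.contDiffAt (hs.mem_nhds hx)).differentiableAt (by simp)).hasFDerivAt
  obtain ⟨e, he⟩ := hinv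
  let h := hfa.toOpenPartialHomeomorph f (he ▸ hder ha) (by simp)
  have hh : ∀ x, h x = f x := fun _ ↦ rfl
  have hopen : IsOpen (s ∩ fderiv ℝ f ⁻¹' range ((↑) : (E ≃L[ℝ] F) → E →L[ℝ] F)) :=
    (hf.continuousOn_fderiv_of_isOpen hs (by simp)).isOpen_inter_preimage hs
      ContinuousLinearEquiv.isOpen
  refine ⟨h.source ∩ (s ∩ fderiv ℝ f ⁻¹' range ((↑) : (E ≃L[ℝ] F) → E →L[ℝ] F)),
    fun x hx ↦ hx.2.1, h.open_source.inter hopen,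
    ⟨hfa.mem_toOpenPartialHomeomorph_source _ _, ha, e, he⟩,
    h.isOpen_image_of_subset_source (h.open_source.inter hopen) inter_subset_left,
    fun x hx ↦ hx.2.2, h.symm, ?_, fun x hx ↦ h.left_inv hx.1⟩
  rintro _ ⟨x, ⟨hx, hxs, e', he'⟩, rfl⟩
  have hx' : h.symm (f x) = x := h.left_inv hx
  refine (h.contDiffAt_symm (f₀' := e') (h.map_source hx) ?_ ?_).contDiffWithinAt
  · rw [hh, hx', he']; exact hder hxs
  · rw [hh, hx']; exact hf.contDiffAt (hs.mem_nhds hxs)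

/-- Smooth dependence on initial conditions near an equilibrium at which the vector field also
vanishes to first order, together with the variational equation. -/
theorem exists_smooth_flow {E : Type} [NormedAddCommGroup E] [NormedSpace ℝ E] [CompleteSpace E]
    {W : Set (ℝ × E)} (hW : IsOpen W) {X : ℝ × E → E} (hX : ContDiffOn ℝ ∞ X W)
    (hW0 : ∀ t ∈ Icc (0 : ℝ) 1, (t, (0 : E)) ∈ W) (hX0 : ∀ t ∈ Icc (0 : ℝ) 1, X (t, 0) = 0)
    (hX0' : ∀ t ∈ Icc (0 : ℝ) 1, ∀ u, fderiv ℝ X (t, 0) (0, u) = 0) :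
    ∃ V : Set E, IsOpen V ∧ (0 : E) ∈ V ∧ ∃ Φ : E → ℝ → E,
      ContDiffOn ℝ ∞ (fun x ↦ Φ x 1) V ∧ (∀ t ∈ Icc (0 : ℝ) 1, Φ 0 t = 0) ∧
      ∀ x ∈ V, Φ x 0 = x ∧
        (∀ t ∈ Icc (0 : ℝ) 1, (t, Φ x t) ∈ W ∧
          HasDerivWithinAt (Φ x) (X (t, Φ x t)) (Icc 0 1) t) ∧
        ∀ u, (∃ J : ℝ → E, J 0 = u ∧ J 1 = fderiv ℝ (fun x ↦ Φ x 1) x u ∧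
            ∀ t ∈ Icc (0 : ℝ) 1,
              HasDerivWithinAt J (fderiv ℝ X (t, Φ x t) (0, J t)) (Icc 0 1) t) ∧
          ∀ J : ℝ → E, J 0 = u →
            (∀ t ∈ Icc (0 : ℝ) 1,
              HasDerivWithinAt J (fderiv ℝ X (t, Φ x t) (0, J t)) (Icc 0 1) t) →
            J 1 = fderiv ℝ (fun x ↦ Φ x 1) x u := by
  classical
  -- The graph map, as a constant plus a linear map.
  let incl : C(I, E) →L[ℝ] C(I, ℝ × E) := (ContinuousLinearMap.inr ℝ ℝ E).compLeftContinuous ℝ I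
  let τ : C(I, ℝ × E) := ⟨fun t ↦ ((t : ℝ), 0), by fun_prop⟩
  let gr : C(I, E) → C(I, ℝ × E) := fun c ↦ τ + incl c
  have gr_apply (c : C(I, E)) (t : I) : gr c t = ((t : ℝ), c t) := by simp [gr, τ, incl]
  have incl_apply (c : C(I, E)) (t : I) : incl c t = (0, c t) := by simp [incl]
  have gr_smooth : ContDiff ℝ ∞ gr := contDiff_const.add incl.contDiff
  have gr_deriv (c) : HasFDerivAt gr incl c := incl.hasFDerivAt.const_add τ
  let Ω : Set (C(I, E)) := gr ⁻¹' {γ | ∀ t, γ t ∈ W}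
  have hΩ : IsOpen Ω := (ContinuousMap.isOpen_setOf_forall_mem hW).preimage gr_smooth.continuous
  have h0Ω : (0 : C(I, E)) ∈ Ω := fun t ↦ by rw [gr_apply]; exact hW0 t t.2
  let P := ContinuousMap.primitive (E := E)
  let G : C(I, E) → C(I, E) := fun c ↦ c - P (ContinuousMap.superpose X (gr c))
  have hG : ContDiffOn ℝ ∞ G Ω := contDiffOn_id.sub
    (P.contDiff.comp_contDiffOn ((hX.superpose hW).comp gr_smooth.contDiffOn fun c hc ↦ hc))
  have hXc : ContinuousOn X W := hX.continuousOn
  have hXc' : ContinuousOn (fderiv ℝ X) W := hX.continuousOn_fderiv_of_isOpen hW (by simp)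
  let B (c : C(I, E)) : C(I, E) →L[ℝ] C(I, E) :=
    (ContinuousMap.pointwiseApply (ContinuousMap.superpose (fderiv ℝ X) (gr c))).comp incl
  have B_apply {c} (hc : c ∈ Ω) (h : C(I, E)) (t : I) :
      B c h t = fderiv ℝ X (t, c t) (0, h t) := by
    simp only [B, ContinuousLinearMap.comp_apply, ContinuousMap.pointwiseApply_apply,
      ContinuousMap.superpose_apply hXc' hc, gr_apply, incl_apply]
  have hG' {c} (hc : c ∈ Ω) : HasFDerivAt G (ContinuousLinearMap.id ℝ _ - P.comp (B c)) c :=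
    (hasFDerivAt_id c).sub (P.hasFDerivAt.comp c
      ((ContinuousMap.hasFDerivAt_superpose hW (hX.of_le (by simp)) hc).comp c (gr_deriv c)))
  have hB0 : B 0 = 0 := by
    ext h t
    rw [B_apply h0Ω]
    exact hX0' t t.2 _
  have hG0 : G 0 = 0 := by
    have : ContinuousMap.superpose X (gr 0) = (0 : C(I, E)) := by
      ext t
      rw [ContinuousMap.superpose_apply hXc h0Ω, gr_apply]
      exact hX0 t t.2
    simp [G, this]
  have hinv : (fderiv ℝ G 0).IsInvertible := by
    rw [(hG' h0Ω).fderiv, hB0, ContinuousLinearMap.comp_zero, sub_zero]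
    exact ⟨ContinuousLinearEquiv.refl ℝ _, rfl⟩
  obtain ⟨T, hTΩ, hT, h0T, hGT, hTinv, Γ, hΓ, hΓG⟩ :=
    hG.exists_smooth_localInverse hΩ h0Ω hinv
  let cst : E →L[ℝ] C(I, E) := ContinuousLinearMap.const ℝ I
  have cst_apply (x : E) : cst x = ContinuousMap.const I x := rfl
  let V : Set E := cst ⁻¹' (G '' T)
  have hV : IsOpen V := hGT.preimage cst.continuous
  have hΓV {x} (hx : x ∈ V) : Γ (cst x) ∈ T ∧ G (Γ (cst x)) = cst x := by
    obtain ⟨c, hc, hcx⟩ := hx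
    rw [← hcx, hΓG c hc]
    exact ⟨hc, rfl⟩
  have hΓ' : ContDiffOn ℝ ∞ (Γ ∘ cst) V := hΓ.comp cst.contDiff.contDiffOn fun _ h ↦ h
  let ev : C(I, E) →L[ℝ] E := ContinuousMap.evalCLM ℝ 1
  let Φ : E → ℝ → E := fun x ↦ Set.IccExtend zero_le_one (Γ (cst x))
  have Φ_apply (x : E) (t : I) : Φ x t = Γ (cst x) t := by simp [Φ]
  have Φ_one : (fun x ↦ Φ x 1) = ev ∘ (Γ ∘ cst) := by
    ext x
    exact Φ_apply x 1
  refine ⟨V, hV, ⟨0, h0T, by simp [hG0]⟩, Φ, ?_, ?_, ?_⟩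
  · rw [Φ_one]
    exact ev.contDiff.comp_contDiffOn hΓ'
  · intro t ht
    have : Γ (cst 0) = 0 := by rw [map_zero]; simpa only [hG0] using hΓG 0 h0T
    rw [Φ_apply 0 ⟨t, ht⟩, this]
    rfl
  intro x hx
  obtain ⟨hcT, hGc⟩ := hΓV hx
  have hcΩ := hTΩ hcT
  set c := Γ (cst x) with hc
  have hceq : c = ContinuousMap.const I x + P (ContinuousMap.superpose X (gr c)) := by
    rw [← cst_apply, ← hGc]; simp [G]
  obtain ⟨hc0, hcd⟩ := ContinuousMap.eq_const_add_primitive_iff.1 hceq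
  have hΓd : HasFDerivAt (Γ ∘ cst) (fderiv ℝ (Γ ∘ cst) x) x :=
    ((hΓ'.contDiffAt (hV.mem_nhds hx)).differentiableAt (by simp)).hasFDerivAt
  have hφd : fderiv ℝ (fun x ↦ Φ x 1) x = ev.comp (fderiv ℝ (Γ ∘ cst) x) := by
    rw [Φ_one]
    exact (ev.hasFDerivAt.comp x hΓd).fderiv
  have hlin : (ContinuousLinearMap.id ℝ _ - P.comp (B c)).comp (fderiv ℝ (Γ ∘ cst) x) = cst := by
    have h1 : HasFDerivAt (G ∘ (Γ ∘ cst)) _ x := (hG' hcΩ).comp x hΓd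
    refine h1.unique (cst.hasFDerivAt.congr_of_eventuallyEq ?_)
    exact Filter.eventually_of_mem (hV.mem_nhds hx) fun y hy ↦ (hΓV hy).2
  have hinj : Function.Injective (ContinuousLinearMap.id ℝ (C(I, E)) - P.comp (B c)) := by
    obtain ⟨e, he⟩ := hTinv c hcT
    rw [← (hG' hcΩ).fderiv, ← he]
    exact e.injective
  have hiff (u : E) (y : C(I, E)) : y = ContinuousMap.const I u + P (B c y) ↔
      y = fderiv ℝ (Γ ∘ cst) x u := by
    rw [← hinj.eq_iff (b := fderiv ℝ (Γ ∘ cst) x u),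
      ← ContinuousLinearMap.comp_apply _ (fderiv ℝ _ x), hlin, cst_apply, ← sub_eq_iff_eq_add]
    rfl
  refine ⟨?_, fun t ht ↦ ⟨?_, ?_⟩, fun u ↦ ⟨?_, fun J hJ0 hJ ↦ ?_⟩⟩
  · exact (Φ_apply x 0).trans hc0
  · have := hcΩ ⟨t, ht⟩
    rw [gr_apply] at this
    rwa [Φ_apply x ⟨t, ht⟩]
  · have := hcd ⟨t, ht⟩
    rw [ContinuousMap.superpose_apply hXc hcΩ, gr_apply] at this
    rw [Φ_apply x ⟨t, ht⟩]
    exact this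
  · let y := fderiv ℝ (Γ ∘ cst) x u
    obtain ⟨hy0, hy⟩ := ContinuousMap.eq_const_add_primitive_iff.1 ((hiff u y).2 rfl)
    refine ⟨Set.IccExtend zero_le_one y, ?_, ?_, fun t ht ↦ ?_⟩
    · rw [← hy0]; simp
    · rw [hφd]; simp [y, ev]
    · have := hy ⟨t, ht⟩
      rw [B_apply hcΩ] at this
      rw [Φ_apply x ⟨t, ht⟩, Set.IccExtend_of_mem _ _ ht]
      exact this
  · have hJc : ContinuousOn J (Icc 0 1) := fun t ht ↦ (hJ t ht).continuousWithinAt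
    let y : C(I, E) := ⟨fun t ↦ J t, hJc.comp_continuous continuous_subtype_val fun t ↦ t.2⟩
    have hy : y = fderiv ℝ (Γ ∘ cst) x u := by
      rw [← hiff, ContinuousMap.eq_const_add_primitive_iff]
      refine ⟨hJ0, fun t ↦ ?_⟩
      rw [B_apply hcΩ]
      have := hJ t t.2
      rw [Φ_apply x t] at this
      refine this.congr_of_mem (fun s hs ↦ ?_) t.2
      rw [Set.IccExtend_of_mem _ _ hs]
      rfl
    rw [hφd, ContinuousLinearMap.comp_apply, ← hy]
    rfl

end SmoothFlow

section Moser

open Set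

theorem ContinuousLinearMap.isInvertible_of_nondegenerate {E : Type*} [NormedAddCommGroup E]
    [NormedSpace ℝ E] [FiniteDimensional ℝ E] (B : E →L[ℝ] E →L[ℝ] ℝ)
    (hB : ∀ u, u ≠ 0 → ∃ v, B u v ≠ 0) : B.IsInvertible := by
  have hinj : Function.Injective (B : E →ₗ[ℝ] E →L[ℝ] ℝ) := by
    rw [injective_iff_map_eq_zero]
    intro u hu
    by_contra hne
    obtain ⟨v, hv⟩ := hB u hne
    exact hv (by simpa using DFunLike.congr_fun hu v)
  have hrank : Module.finrank ℝ E = Module.finrank ℝ (E →L[ℝ] ℝ) := by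
    rw [← (LinearMap.toContinuousLinearMap (𝕜 := ℝ) (E := E) (F' := ℝ)).finrank_eq]
    exact (Subspace.dual_finrank_eq (K := ℝ) (V := E)).symm
  exact ⟨(LinearEquiv.ofInjectiveOfFinrankEq _ hinj hrank).toContinuousLinearEquiv, rfl⟩

namespace EquivariantDarboux

variable {E : Type} [NormedAddCommGroup E] [NormedSpace ℝ E]

section Path

variable {G : Type} [NormedAddCommGroup G] [NormedSpace ℝ G] {U : Set E} {ω : E → G} {p : ℝ × E}

/-- The linear path from the constant map `ω 0` to `ω`. -/
noncomputable def formPath (ω : E → G) (p : ℝ × E) : G :=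
  ω 0 + p.1 • (ω p.2 - ω 0)

omit [NormedSpace ℝ E] in
theorem formPath_zero (ω : E → G) (t : ℝ) : formPath ω (t, 0) = ω 0 := by
  simp [formPath]

theorem contDiffOn_formPath (hω : ContDiffOn ℝ (⊤ : ℕ∞) ω U) :
    ContDiffOn ℝ (⊤ : ℕ∞) (formPath ω) (Prod.snd ⁻¹' U) := by
  have h : ContDiffOn ℝ (⊤ : ℕ∞) (fun p : ℝ × E ↦ ω p.2) (Prod.snd ⁻¹' U) :=
    hω.comp contDiff_snd.contDiffOn fun _ h ↦ h
  exact contDiffOn_const.add (contDiff_fst.contDiffOn.smul (h.sub contDiffOn_const))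

theorem hasFDerivAt_sub_apply_zero (hω : DifferentiableAt ℝ ω p.2) :
    HasFDerivAt (fun p : ℝ × E ↦ ω p.2 - ω 0) ((fderiv ℝ ω p.2).comp (.snd ℝ ℝ E)) p :=
  (hω.hasFDerivAt.comp p hasFDerivAt_snd).sub_const _

theorem hasFDerivAt_formPath (hω : DifferentiableAt ℝ ω p.2) :
    HasFDerivAt (formPath ω) (p.1 • (fderiv ℝ ω p.2).comp (.snd ℝ ℝ E) +
      (ContinuousLinearMap.fst ℝ ℝ E).smulRight (ω p.2 - ω 0)) p :=
  (hasFDerivAt_fst.smul (hasFDerivAt_sub_apply_zero hω)).const_add _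

end Path

/-- Moser's time-dependent vector field `X`, with `ι_X ω_t = -ι_S (ω - ω 0)` for `S x = A x`. -/
noncomputable def moserField (ω : E → E →L[ℝ] E →L[ℝ] ℝ) (A : E →L[ℝ] E) (p : ℝ × E) : E :=
  (formPath ω p).inverse (-(ω p.2 - ω 0) (A p.2))

/-- The domain on which Moser's vector field is defined. -/
def moserDomain (U : Set E) (ω : E → E →L[ℝ] E →L[ℝ] ℝ) : Set (ℝ × E) :=
  {p | p.2 ∈ U ∧ (formPath ω p).IsInvertible}

variable {U : Set E} {ω : E → E →L[ℝ] E →L[ℝ] ℝ} {A : E →L[ℝ] E}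

theorem formPath_moserField {p : ℝ × E} (hp : p ∈ moserDomain U ω) :
    formPath ω p (moserField ω A p) = -(ω p.2 - ω 0) (A p.2) :=
  hp.2.self_apply_inverse _

variable [CompleteSpace E]

theorem isOpen_moserDomain (hU : IsOpen U) (hω : ContDiffOn ℝ (⊤ : ℕ∞) ω U) :
    IsOpen (moserDomain U ω) :=
  (contDiffOn_formPath hω).continuousOn.isOpen_inter_preimage (hU.preimage continuous_snd)
    (ContinuousLinearEquiv.isOpen (𝕜 := ℝ) (E := E) (F := E →L[ℝ] ℝ))

theorem contDiffOn_moserField (hU : IsOpen U) (hω : ContDiffOn ℝ (⊤ : ℕ∞) ω U) :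
    ContDiffOn ℝ (⊤ : ℕ∞) (moserField ω A) (moserDomain U ω) := by
  intro p hp
  have hω' : ContDiffAt ℝ (⊤ : ℕ∞) ω p.2 := hω.contDiffAt (hU.mem_nhds hp.1)
  have h1 : ContDiffAt ℝ (⊤ : ℕ∞) (formPath ω) p :=
    (contDiffOn_formPath hω).contDiffAt ((hU.preimage continuous_snd).mem_nhds hp.1)
  have h2 : ContDiffAt ℝ (⊤ : ℕ∞) (fun q : ℝ × E ↦ ω q.2) p := hω'.comp p contDiffAt_snd
  have h3 : ContDiffAt ℝ (⊤ : ℕ∞) (fun q : ℝ × E ↦ A q.2) p :=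
    A.contDiff.contDiffAt.comp p contDiffAt_snd
  exact ((hp.2.contDiffAt_map_inverse.comp p h1).clm_apply
    ((h2.sub contDiffAt_const).clm_apply h3).neg).contDiffWithinAt

/-- The spatial derivative of the identity defining Moser's vector field. -/
theorem formPath_fderiv_moserField (hU : IsOpen U) (hω : ContDiffOn ℝ (⊤ : ℕ∞) ω U) {p : ℝ × E}
    (hp : p ∈ moserDomain U ω) (u v : E) :
    p.1 * fderiv ℝ ω p.2 u (moserField ω A p) v +
        formPath ω p (fderiv ℝ (moserField ω A) p (0, u)) v =
      -(fderiv ℝ ω p.2 u (A p.2) v) - (ω p.2 - ω 0) (A u) v := by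
  have hW := isOpen_moserDomain hU hω
  have hω' : DifferentiableAt ℝ ω p.2 :=
    (hω.contDiffAt (hU.mem_nhds hp.1)).differentiableAt (by simp)
  have hX : HasFDerivAt (moserField ω A) (fderiv ℝ (moserField ω A) p) p :=
    (((contDiffOn_moserField hU hω).contDiffAt (hW.mem_nhds hp)).differentiableAt
      (by simp)).hasFDerivAt
  have h1 := (hasFDerivAt_formPath (G := E →L[ℝ] E →L[ℝ] ℝ) (p := p) hω').clm_apply hX
  have h2 := hasFDerivAt_sub_apply_zero (G := E →L[ℝ] E →L[ℝ] ℝ) (p := p) hω'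
  have h3 : HasFDerivAt (fun p : ℝ × E ↦ A p.2) (A.comp (.snd ℝ ℝ E)) p :=
    A.hasFDerivAt.comp p hasFDerivAt_snd
  have h4 := (h2.clm_apply h3).neg.congr_of_eventuallyEq (Filter.eventually_of_mem
    (hW.mem_nhds hp) fun q hq ↦ formPath_moserField (A := A) hq)
  have h5 := DFunLike.congr_fun (DFunLike.congr_fun (h1.unique h4) (0, u)) v
  simp at h5 ⊢
  linarith

theorem lieDeriv_formPath (hU : IsOpen U) (h0 : 0 ∈ U) (hω : ContDiffOn ℝ (⊤ : ℕ∞) ω U)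
    (hanti : ∀ x ∈ U, ∀ u v, ω x u v = -ω x v u)
    (hclosed : ∀ x ∈ U, ∀ u v w,
      fderiv ℝ ω x u v w - fderiv ℝ ω x v u w + fderiv ℝ ω x w u v = 0)
    (hLS : ∀ x ∈ U, ∀ u v, fderiv ℝ ω x (A x) u v + ω x (A u) v + ω x u (A v) = ω x u v)
    {p : ℝ × E} (hp : p ∈ moserDomain U ω) (u v : E) :
    p.1 * fderiv ℝ ω p.2 (moserField ω A p) u v +
        formPath ω p (fderiv ℝ (moserField ω A) p (0, u)) v +
        formPath ω p u (fderiv ℝ (moserField ω A) p (0, v)) = -(ω p.2 - ω 0) u v := by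
  have h1 := formPath_fderiv_moserField (A := A) hU hω hp u v
  have h2 := formPath_fderiv_moserField (A := A) hU hω hp v u
  have h3 := hclosed _ hp.1 (moserField ω A p) u v
  have h4 := hclosed _ hp.1 (A p.2) u v
  have h5 := hLS _ hp.1 u v
  have h6 := hLS _ h0 u v
  have hf (a b : E) : formPath ω p a b = -formPath ω p b a := by
    simp only [formPath, add_apply, sub_apply, smul_apply,
      smul_eq_mul]
    rw [hanti _ hp.1 a b, hanti _ h0 a b]
    ring
  rw [hf u]
  simp only [map_zero, zero_apply, sub_apply] at h1 h2 h6 ⊢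
  linear_combination h1 - h2 + p.1 * h3 + h4 - h5 + h6 + hanti _ hp.1 (A v) u -
    hanti _ h0 (A v) u

theorem moserField_commutes (hU : IsOpen U) (h0 : 0 ∈ U) (hω : ContDiffOn ℝ (⊤ : ℕ∞) ω U)
    (hLS : ∀ x ∈ U, ∀ u v, fderiv ℝ ω x (A x) u v + ω x (A u) v + ω x u (A v) = ω x u v)
    {p : ℝ × E} (hp : p ∈ moserDomain U ω) :
    fderiv ℝ (moserField ω A) p (0, A p.2) = A (moserField ω A p) := by
  obtain ⟨e, he⟩ := hp.2
  apply e.injective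
  ext v
  change (e : E →L[ℝ] E →L[ℝ] ℝ) _ v = (e : E →L[ℝ] E →L[ℝ] ℝ) _ v
  rw [he]
  have h1 := formPath_fderiv_moserField (A := A) hU hω hp (A p.2) v
  have h2 := hLS _ hp.1 (moserField ω A p) v
  have h3 := hLS _ h0 (moserField ω A p) v
  have h4 := hLS _ hp.1 (A p.2) v
  have h5 := hLS _ h0 (A p.2) v
  have h6 := DFunLike.congr_fun (formPath_moserField (A := A) hp) v
  have h7 := DFunLike.congr_fun (formPath_moserField (A := A) hp) (A v)
  simp only [formPath, map_zero, zero_apply, add_apply, sub_apply, smul_apply, neg_apply,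
    smul_eq_mul] at h1 h2 h3 h4 h5 h6 h7 ⊢
  linear_combination h1 - p.1 * h2 - (1 - p.1) * h3 - h4 + h5 + h7 - h6

end EquivariantDarboux

open EquivariantDarboux in
theorem exists_equivariant_darboux_chart {E : Type} [NormedAddCommGroup E] [NormedSpace ℝ E]
    [FiniteDimensional ℝ E] {U : Set E} (hU : IsOpen U) (h0 : (0 : E) ∈ U)
    {ω : E → E →L[ℝ] E →L[ℝ] ℝ} (hω : ContDiffOn ℝ (⊤ : ℕ∞) ω U)
    (hanti : ∀ x ∈ U, ∀ u, ω x u u = 0)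
    (hclosed : ∀ x ∈ U, ∀ u v w,
      fderiv ℝ ω x u v w - fderiv ℝ ω x v u w + fderiv ℝ ω x w u v = 0)
    (hnondeg : ∀ u : E, u ≠ 0 → ∃ v, ω 0 u v ≠ 0) {A : E →L[ℝ] E}
    (hLS : ∀ x ∈ U, ∀ u v, fderiv ℝ ω x (A x) u v + ω x (A u) v + ω x u (A v) = ω x u v) :
    ∃ V : Set E, IsOpen V ∧ (0 : E) ∈ V ∧ ∃ φ : E → E, ContDiffOn ℝ (⊤ : ℕ∞) φ V ∧ φ 0 = 0 ∧
      fderiv ℝ φ 0 = ContinuousLinearMap.id ℝ E ∧ ∀ x ∈ V, φ x ∈ U ∧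
        (∀ u v, ω (φ x) (fderiv ℝ φ x u) (fderiv ℝ φ x v) = ω 0 u v) ∧
        fderiv ℝ φ x (A x) = A (φ x) := by
  have : CompleteSpace E := FiniteDimensional.complete ℝ E
  have hskew : ∀ x ∈ U, ∀ u v, ω x u v = -ω x v u := by
    intro x hx u v
    have h := hanti x hx (u + v)
    simp only [map_add, add_apply, hanti x hx, zero_add, add_zero] at h
    linarith
  have hinv := (ω 0).isInvertible_of_nondegenerate hnondeg
  have hmem (t : ℝ) : (t, (0 : E)) ∈ moserDomain U ω := ⟨h0, by rwa [formPath_zero]⟩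
  have hX0 (t : ℝ) : moserField ω A (t, 0) = 0 := by simp [moserField]
  have hX0' (t : ℝ) (u : E) : fderiv ℝ (moserField ω A) (t, 0) (0, u) = 0 := by
    obtain ⟨e, he⟩ := hinv
    apply e.injective
    ext v
    change (e : E →L[ℝ] E →L[ℝ] ℝ) _ v = (e : E →L[ℝ] E →L[ℝ] ℝ) _ v
    have h := formPath_fderiv_moserField (A := A) hU hω (hmem t) u v
    rw [formPath_zero, hX0] at h
    rw [he]
    simpa using h
  obtain ⟨V, hV, h0V, Φ, hΦ, hΦ0, hflow⟩ := exists_smooth_flow (isOpen_moserDomain hU hω)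
    (contDiffOn_moserField (A := A) hU hω) (fun t _ ↦ hmem t) (fun t _ ↦ hX0 t)
    (fun t _ ↦ hX0' t)
  have h1 : (1 : ℝ) ∈ Icc (0 : ℝ) 1 := by simp
  refine ⟨V, hV, h0V, fun x ↦ Φ x 1, hΦ, hΦ0 1 h1, ?_, fun x hx ↦ ?_⟩
  · ext1 u
    refine (((hflow 0 h0V).2.2 u).2 (fun _ ↦ u) rfl fun t ht ↦ ?_).symm
    rw [hΦ0 t ht, hX0']
    exact hasDerivWithinAt_const _ _ _
  obtain ⟨hx0, hode, hvar⟩ := hflow x hx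
  refine ⟨(hode 1 h1).1.1, fun u v ↦ ?_, ?_⟩
  · obtain ⟨J, hJ0, hJ1, hJ⟩ := (hvar u).1
    obtain ⟨K, hK0, hK1, hK⟩ := (hvar v).1
    have hder : ∀ t ∈ Icc (0 : ℝ) 1,
        HasDerivWithinAt (fun t ↦ formPath ω (t, Φ x t) (J t) (K t)) 0 (Icc 0 1) t := by
      intro t ht
      have hp := (hode t ht).1
      have hω' : DifferentiableAt ℝ ω (Φ x t) :=
        (hω.contDiffAt (hU.mem_nhds hp.1)).differentiableAt (by simp)
      have hF := HasFDerivAt.comp_hasDerivWithinAt (f := fun t ↦ (t, Φ x t)) t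
        (hasFDerivAt_formPath (G := E →L[ℝ] E →L[ℝ] ℝ) hω')
        ((hasDerivWithinAt_id t _).prodMk (hode t ht).2)
      refine ((hF.clm_apply (hJ t ht)).clm_apply (hK t ht)).congr_deriv ?_
      have h := lieDeriv_formPath hU h0 hω hskew hclosed hLS hp (J t) (K t)
      simp at h ⊢
      linarith
    have hconst := constant_of_derivWithin_zero
      (fun t ht ↦ (hder t ht).differentiableWithinAt)
      (fun t ht ↦ (hder t (Ico_subset_Icc_self ht)).derivWithin
        (uniqueDiffOn_Icc one_pos t (Ico_subset_Icc_self ht))) 1 h1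
    simpa [formPath, hJ0, hK0, hJ1, hK1] using hconst
  · refine ((hvar (A x)).2 (fun t ↦ A (Φ x t)) (by rw [hx0]) fun t ht ↦ ?_).symm
    have h := moserField_commutes hU h0 hω hLS (hode t ht).1
    rw [h]
    exact A.hasFDerivAt.comp_hasDerivWithinAt t (hode t ht).2

end Moser
/-- (Equivariant Darboux lemma, Lemma 2.2 of the paper.) Let `ω` be a smooth
closed nondegenerate 2-form near `0` in `ℝ^{2n}`, `A` a real `(2n)×(2n)` matrix with linear
vector field `S(x) = Ax`, and assume `L_S ω = ω`. Then there is a local diffeomorphism `φ`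
with `φ(0) = 0` and `Dφ(0) = id` such that `φ*ω` is the constant form `ω(0)` and `φ`
preserves `S`: `Dφ(x)(Ax) = A·φ(x)`. -/
theorem equivariant_darboux
    (n : ℕ)
    (U : Set (Fin (n+n) → ℝ)) (hU : IsOpen U) (h0U : (0 : Fin (n+n) → ℝ) ∈ U)
    (ω : (Fin (n+n) → ℝ) → (Fin (n+n) → ℝ) →L[ℝ] (Fin (n+n) → ℝ) →L[ℝ] ℝ)
    (hωsmooth : ContDiffOn ℝ (⊤ : ℕ∞) ω U)
    (hωalt : ∀ x ∈ U, ∀ u, ω x u u = 0)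
    -- ω is closed :
    (hclosed : ∀ x ∈ U, ∀ u v w : Fin (n+n) → ℝ,
      fderiv ℝ ω x u v w - fderiv ℝ ω x v u w + fderiv ℝ ω x w u v = 0)
    -- ω is nondegenerate :
    (hnondeg : ∀ x ∈ U, ∀ u : Fin (n+n) → ℝ, u ≠ 0 → ∃ v, ω x u v ≠ 0)
    -- the linear vector field S(x) = Ax of a real matrix A, with L_S ω = ω :
    (A : Matrix (Fin (n+n)) (Fin (n+n)) ℝ)
    (hLS : ∀ x ∈ U, ∀ u v,
      fderiv ℝ ω x (A.mulVec x) u v + ω x (A.mulVec u) v + ω x u (A.mulVec v) = ω x u v) :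
    ∃ V : Set (Fin (n+n) → ℝ), IsOpen V ∧ (0 : Fin (n+n) → ℝ) ∈ V ∧
    ∃ φ ψ : (Fin (n+n) → ℝ) → (Fin (n+n) → ℝ),
      φ 0 = 0 ∧
      fderiv ℝ φ 0 = ContinuousLinearMap.id ℝ (Fin (n+n) → ℝ) ∧
      ContDiffOn ℝ (⊤ : ℕ∞) φ V ∧
      Set.InjOn φ V ∧ IsOpen (φ '' V) ∧
      ContDiffOn ℝ (⊤ : ℕ∞) ψ (φ '' V) ∧
      (∀ x ∈ V, ψ (φ x) = x) ∧ (∀ y ∈ φ '' V, φ (ψ y) = y) ∧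
      (∀ x ∈ V, φ x ∈ U) ∧
      -- (a) φ*ω is the constant 2-form ω(0) :
      (∀ x ∈ V, ∀ u v,
        ω (φ x) (fderiv ℝ φ x u) (fderiv ℝ φ x v) = ω 0 u v) ∧
      -- (b) φ preserves S :
      (∀ x ∈ V, fderiv ℝ φ x (A.mulVec x) = A.mulVec (φ x)) := by
  obtain ⟨V, hV, h0V, φ, hφ, hφ0, hφ0', hφV⟩ := exists_equivariant_darboux_chart hU h0U hωsmooth
    hωalt hclosed (hnondeg 0 h0U) (A := LinearMap.toContinuousLinearMap A.mulVecLin) hLS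
  obtain ⟨T, hTV, hT, h0T, hφT, -, ψ, hψ, hψφ⟩ := hφ.exists_smooth_localInverse hV h0V
    ⟨ContinuousLinearEquiv.refl ℝ _, hφ0'.symm⟩
  refine ⟨T, hT, h0T, φ, ψ, hφ0, hφ0', hφ.mono hTV, ?_, hφT, hψ, hψφ, ?_,
    fun x hx ↦ (hφV x (hTV hx)).1, fun x hx ↦ (hφV x (hTV hx)).2.1,
    fun x hx ↦ (hφV x (hTV hx)).2.2⟩
  · exact fun x hx y hy hxy ↦ by rw [← hψφ x hx, hxy, hψφ y hy]
  · rintro _ ⟨x, hx, rfl⟩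
    rw [hψφ x hx]
end

section
/- Let h be a smooth real-valued function on a neighborhood of (0,0) in ℝ² (variables (x, θ)) with h(0,0) ≠ 0. Then there exists a smooth function g on a neighborhood of 0 in ℝ such that for all sufficiently small x ≥ 0: ∫_{−√x}^{x·g(x)} h(x,θ)(θ² − x) dθ = ∫_{x·g(x)}^{√x} h(x,θ)(θ² − x) dθ. -/
open scoped Topology ContDiff
open Set Filter

theorem contDiff_nat_parametric_intervalIntegral {E : Type} [NormedAddCommGroup E]
    [NormedSpace ℝ E] [ProperSpace E] (a b : ℝ) (n : ℕ) :
    ∀ {G : Type} [NormedAddCommGroup G] [NormedSpace ℝ G] [CompleteSpace G] {f : E × ℝ → G},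
      ContDiff ℝ n f → ContDiff ℝ n fun x => ∫ t in a..b, f (x, t) := by
  induction n with
  | zero =>
    intro G _ _ _ f hf
    rw [Nat.cast_zero, contDiff_zero] at *
    exact intervalIntegral.continuous_parametric_intervalIntegral_of_continuous'
      (f := fun x t => f (x, t)) hf a b
  | succ n ih =>
    intro G _ _ _ f hf
    have hf1 : ContDiff ℝ ((n : ℕ∞ω) + 1) f := by exact_mod_cast hf
    have hd : Differentiable ℝ f := hf.differentiable (by simp)
    have hF : ContDiff ℝ n fun p => (fderiv ℝ f p).comp (ContinuousLinearMap.inl ℝ E ℝ) :=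
      (hf1.fderiv_right le_rfl).clm_comp contDiff_const
    push_cast
    rw [contDiff_succ_iff_hasFDerivAt]
    refine ⟨fun x => ∫ t in a..b, (fderiv ℝ f (x, t)).comp (ContinuousLinearMap.inl ℝ E ℝ),
      ih hF, fun x => ?_⟩
    obtain ⟨C, hC⟩ := ((isCompact_closedBall x 1).prod isCompact_uIcc).exists_bound_of_continuousOn
      (s := Metric.closedBall x 1 ×ˢ uIcc a b) hF.continuous.continuousOn
    refine (intervalIntegral.hasFDerivAt_integral_of_dominated_of_fderiv_le
      (F := fun x t => f (x, t)) (bound := fun _ => C)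
      (F' := fun x t => (fderiv ℝ f (x, t)).comp (ContinuousLinearMap.inl ℝ E ℝ))
      (Metric.closedBall_mem_nhds x one_pos) ?_ ?_ ?_ ?_ ?_ ?_)
    · exact Eventually.of_forall fun y =>
        (hf.continuous.comp (by fun_prop : Continuous fun t : ℝ => (y, t))).aestronglyMeasurable
    · exact (hf.continuous.comp
        (by fun_prop : Continuous fun t : ℝ => (x, t))).intervalIntegrable _ _
    · exact (hF.continuous.comp
        (by fun_prop : Continuous fun t : ℝ => (x, t))).aestronglyMeasurable
    · exact Eventually.of_forall fun t ht y hy => hC (y, t) ⟨hy, uIoc_subset_uIcc ht⟩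
    · exact intervalIntegrable_const
    · exact Eventually.of_forall fun t _ y _ =>
        (hd (y, t)).hasFDerivAt.comp y (hasFDerivAt_prodMk_left y t)

theorem contDiff_parametric_intervalIntegral {E G : Type} [NormedAddCommGroup E]
    [NormedSpace ℝ E] [ProperSpace E] [NormedAddCommGroup G] [NormedSpace ℝ G] [CompleteSpace G]
    {f : E × ℝ → G} (hf : ContDiff ℝ ∞ f) (a b : ℝ) :
    ContDiff ℝ ∞ fun x => ∫ t in a..b, f (x, t) :=
  contDiff_infty.2 fun n => contDiff_nat_parametric_intervalIntegral a b n (contDiff_infty.1 hf n)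

theorem ContDiff.exists_eq_mul_of_apply_zero {f : ℝ → ℝ} (hf : ContDiff ℝ ∞ f) (h0 : f 0 = 0) :
    ∃ g : ℝ → ℝ, ContDiff ℝ ∞ g ∧ ∀ s, f s = s * g s := by
  have hd : ContDiff ℝ ∞ (deriv f) := (contDiff_infty_iff_deriv.1 hf).2
  refine ⟨fun s => ∫ t in (0 : ℝ)..1, deriv f (s * t),
    contDiff_parametric_intervalIntegral (f := fun p : ℝ × ℝ => deriv f (p.1 * p.2))
      (hd.comp (contDiff_fst.mul contDiff_snd)) 0 1, fun s => ?_⟩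
  have := intervalIntegral.mul_integral_comp_mul_left (f := deriv f) (a := 0) (b := 1) s
  rw [this, intervalIntegral.integral_deriv_eq_sub]
  · simp [h0]
  · exact fun x _ => (hf.differentiable (by simp)).differentiableAt
  · exact hd.continuous.intervalIntegrable _ _

theorem ContDiff.exists_even_eq_mul_of_odd {f : ℝ → ℝ} (hf : ContDiff ℝ ∞ f)
    (ho : Function.Odd f) :
    ∃ g : ℝ → ℝ, ContDiff ℝ ∞ g ∧ Function.Even g ∧ ∀ s, f s = s * g s := by
  obtain ⟨g, hg, hfg⟩ := hf.exists_eq_mul_of_apply_zero ho.map_zero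
  refine ⟨g, hg, fun s => ?_, hfg⟩
  rcases eq_or_ne s 0 with rfl | hs
  · simp
  · have := ho s
    rw [hfg, hfg] at this
    exact mul_left_cancel₀ hs (by linarith)

theorem ContDiff.exists_even_deriv_eq_mul {f : ℝ → ℝ} (hf : ContDiff ℝ ∞ f)
    (he : Function.Even f) :
    ∃ g : ℝ → ℝ, (ContDiff ℝ ∞ g ∧ Function.Even g) ∧ ∀ s, deriv f s = 2 * s * g s := by
  have hodd : Function.Odd (deriv f) := fun s => by
    have := deriv_comp_neg f s
    rw [show (fun x => f (-x)) = f from funext he] at this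
    linarith
  obtain ⟨g, hg, hge, hfg⟩ := (contDiff_infty_iff_deriv.1 hf).2.exists_even_eq_mul_of_odd hodd
  exact ⟨fun s => g s / 2, ⟨hg.div_const 2, fun s => by simp [hge s]⟩,
    fun s => by rw [hfg]; ring⟩

theorem contDiff_of_hasDerivAt_succ {F : ℕ → ℝ → ℝ}
    (hF : ∀ n x, HasDerivAt (F n) (F (n + 1) x) x) (m : ℕ) : ContDiff ℝ ∞ (F m) := by
  refine contDiff_infty.2 fun n => ?_
  induction n generalizing m with
  | zero => exact contDiff_zero.2 (continuous_iff_continuousAt.2 fun x => (hF m x).continuousAt)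
  | succ n ih =>
    push_cast
    refine contDiff_succ_iff_deriv.2 ⟨fun x => (hF m x).differentiableAt, by simp, ?_⟩
    rw [show deriv (F m) = F (m + 1) from funext fun x => (hF m x).deriv]
    exact ih _

theorem hasDerivWithinAt_comp_sqrt {f g : ℝ → ℝ} (hf : ContDiff ℝ ∞ f) (hg : ContDiff ℝ ∞ g)
    (hfg : ∀ s, deriv f s = 2 * s * g s) {x : ℝ} (hx : 0 ≤ x) :
    HasDerivWithinAt (fun y => f (√y)) (g (√x)) (Ici 0) x := by
  have hpos : ∀ y, 0 < y → HasDerivAt (fun y => f (√y)) (g (√y)) y := fun y hy => by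
    have h := ((hf.differentiable (by simp)) (√y)).hasDerivAt.comp y
      (Real.hasDerivAt_sqrt hy.ne')
    have h0 : √y ≠ 0 := (Real.sqrt_pos.2 hy).ne'
    convert! h using 1
    rw [hfg]
    field_simp
  rcases hx.eq_or_lt with rfl | hx
  · refine hasDerivWithinAt_Ici_of_tendsto_deriv (s := Ioi 0)
      (fun y hy => (hpos y hy).differentiableAt.differentiableWithinAt)
      (hf.continuous.comp Real.continuous_sqrt).continuousWithinAt self_mem_nhdsWithin ?_
    refine Tendsto.congr' (f₁ := fun y => g (√y)) ?_
      ((hg.continuous.comp Real.continuous_sqrt).tendsto 0 |>.mono_left nhdsWithin_le_nhds)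
    filter_upwards [self_mem_nhdsWithin] with y hy using (hpos y hy).deriv.symm
  · exact (hpos x hx).hasDerivWithinAt

theorem exists_contDiff_iteratedDeriv_eq (a : ℕ → ℝ) :
    ∃ b : ℝ → ℝ, ContDiff ℝ ∞ b ∧ ∀ n, iteratedDeriv n b 0 = a n := by
  let χ : ContDiffBump (0 : ℝ) := default
  let φ : ℕ → ℝ → ℝ := fun n y => y ^ n * χ y
  have hφ : ∀ n, ContDiff ℝ ∞ (φ n) := fun n => (contDiff_id.pow n).mul χ.contDiff
  have hM : ∀ n k, ∃ M, ∀ y, ‖iteratedDeriv k (φ n) y‖ ≤ M := fun n k => by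
    obtain ⟨M, hM⟩ := ((χ.hasCompactSupport.mul_left (f := fun y : ℝ => y ^ n)).iteratedFDeriv
      (𝕜 := ℝ) k).exists_bound_of_continuous
      ((hφ n).continuous_iteratedFDeriv (by exact_mod_cast le_top))
    exact ⟨M, fun y => by
      rw [← norm_iteratedFDeriv_eq_norm_iteratedDeriv]; exact hM y⟩
  choose M hM using hM
  have hM0 : ∀ n k, 0 ≤ M n k := fun n k => (norm_nonneg _).trans (hM n k 0)
  let c : ℕ → ℝ := fun n => a n / n.factorial
  let l : ℕ → ℝ := fun n => 1 + 2 ^ n * (|c n| * ∑ k ∈ Finset.range n, M n k)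
  have hl : ∀ n, 1 ≤ l n := fun n => le_add_of_nonneg_right (mul_nonneg (by positivity)
    (mul_nonneg (abs_nonneg _) (Finset.sum_nonneg fun k _ => hM0 n k)))
  have hl0 : ∀ n, 0 < l n := fun n => one_pos.trans_le (hl n)
  let f : ℕ → ℝ → ℝ := fun n x => c n / l n ^ n * φ n (l n * x)
  have hf : ∀ n, ContDiff ℝ ∞ (f n) := fun n =>
    contDiff_const.mul ((hφ n).comp (contDiff_const.mul contDiff_id))
  have hfd : ∀ n k x, iteratedDeriv k (f n) x =
      c n / l n ^ n * (l n ^ k * iteratedDeriv k (φ n) (l n * x)) := fun n k x => by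
    simp only [f]
    rw [iteratedDeriv_const_mul_field, iteratedDeriv_comp_const_mul (contDiff_infty.1 (hφ n) k)]
  let v : ℕ → ℕ → ℝ := fun k n =>
    if k < n then (1 / 2) ^ n else |c n| / l n ^ n * (l n ^ k * M n k)
  have hv : ∀ k, Summable (v k) := fun k => by
    refine summable_geometric_two.congr_atTop ?_
    filter_upwards [eventually_gt_atTop k] with n hn
    simp [v, hn]
  have hfv : ∀ k n x, ‖iteratedFDeriv ℝ k (f n) x‖ ≤ v k n := fun k n x => by
    rw [norm_iteratedFDeriv_eq_norm_iteratedDeriv, hfd]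
    have h1 : ‖c n / l n ^ n * (l n ^ k * iteratedDeriv k (φ n) (l n * x))‖ ≤
        |c n| / l n ^ n * (l n ^ k * M n k) := by
      rw [norm_mul, norm_mul, norm_div, norm_pow, norm_pow, Real.norm_of_nonneg (hl0 n).le,
        Real.norm_eq_abs (c n)]
      have := hl0 n
      gcongr
      exact hM _ _ _
    refine h1.trans ?_
    simp only [v]
    split_ifs with hkn
    · have h2 : l n ^ k * l n ≤ l n ^ n := by
        rw [← pow_succ]; exact pow_le_pow_right₀ (hl n) hkn
      have h3 : 2 ^ n * (|c n| * M n k) ≤ l n := by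
        have : M n k ≤ ∑ k ∈ Finset.range n, M n k :=
          Finset.single_le_sum (fun k _ => hM0 n k) (Finset.mem_range.2 hkn)
        calc _ ≤ 2 ^ n * (|c n| * ∑ k ∈ Finset.range n, M n k) := by gcongr
          _ ≤ l n := by simp only [l]; linarith
      have h4 : 0 < l n ^ n := pow_pos (hl0 n) n
      rw [div_mul_eq_mul_div, one_div_pow, div_le_div_iff₀ h4 (by positivity), one_mul]
      calc _ = l n ^ k * (2 ^ n * (|c n| * M n k)) := by ring
        _ ≤ l n ^ k * l n := by have := hl0 n; gcongr
        _ ≤ _ := h2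
    · exact le_rfl
  have hf0 : ∀ n k, iteratedDeriv k (f n) 0 = if k = n then a n else 0 := fun n k => by
    have : f n =ᶠ[𝓝 0] fun x => c n * x ^ n := by
      have h1 : Tendsto (fun x => l n * x) (𝓝 0) (𝓝 0) := by
        simpa using (continuous_const_mul (l n)).tendsto 0
      filter_upwards [h1.eventually χ.eventuallyEq_one] with x hx
      have := (hl0 n).ne'
      simp only [f, φ, hx, Pi.one_apply, mul_pow]
      field_simp
    rw [this.iteratedDeriv_eq, iteratedDeriv_const_mul_field, iteratedDeriv_fun_pow_zero]
    have := Nat.factorial_ne_zero n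
    split_ifs
    · simp only [c]; field_simp
    · simp
  refine ⟨fun x => ∑' n, f n x, contDiff_tsum (N := ⊤) hf (fun k _ => hv k)
    fun k n x _ => hfv k n x, fun k => ?_⟩
  rw [iteratedDeriv_eq_iteratedFDeriv, iteratedFDeriv_tsum_apply (N := ⊤) hf (fun k _ => hv k)
    (fun k n x _ => hfv k n x) le_top, tsum_eq_single k, ← iteratedDeriv_eq_iteratedFDeriv, hf0,
    if_pos rfl]
  intro n hn
  rw [← norm_eq_zero, norm_iteratedFDeriv_eq_norm_iteratedDeriv, hf0, if_neg hn.symm, norm_zero]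

/-- **Whitney's theorem**: a smooth even function of `s` is a smooth function of `s ^ 2`. -/
theorem ContDiff.exists_eq_comp_sq_of_even {f : ℝ → ℝ} (hf : ContDiff ℝ ∞ f)
    (he : Function.Even f) : ∃ e : ℝ → ℝ, ContDiff ℝ ∞ e ∧ ∀ s, f s = e (s ^ 2) := by
  choose D hD hD' using fun g : {g : ℝ → ℝ // ContDiff ℝ ∞ g ∧ Function.Even g} =>
    g.2.1.exists_even_deriv_eq_mul g.2.2
  let S : ℕ → {g : ℝ → ℝ // ContDiff ℝ ∞ g ∧ Function.Even g} :=
    Nat.rec ⟨f, hf, he⟩ fun _ g => ⟨D g, hD g⟩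
  obtain ⟨b, hb, hb0⟩ := exists_contDiff_iteratedDeriv_eq fun n => (S n).1 0
  let F : ℕ → ℝ → ℝ := fun n x => if 0 ≤ x then (S n).1 (√x) else iteratedDeriv n b x
  have hpos : ∀ n x, 0 ≤ x → HasDerivWithinAt (F n) (F (n + 1) x) (Ici 0) x := fun n x hx => by
    have h1 := hasDerivWithinAt_comp_sqrt (S n).2.1 (S (n + 1)).2.1 (hD' (S n)) hx
    rw [show F (n + 1) x = (S (n + 1)).1 (√x) from if_pos hx]
    exact h1.congr (fun y hy => if_pos hy) (if_pos hx)
  have hnonpos : ∀ n x, x ≤ 0 → F n x = iteratedDeriv n b x := fun n x hx => by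
    rcases hx.lt_or_eq with hx | rfl
    · exact if_neg hx.not_ge
    · simp [F, hb0]
  have hneg : ∀ n x, x ≤ 0 → HasDerivWithinAt (F n) (F (n + 1) x) (Iic 0) x := fun n x hx => by
    have h1 : HasDerivAt (iteratedDeriv n b) (iteratedDeriv (n + 1) b x) x := by
      rw [iteratedDeriv_succ]
      exact (hb.differentiable_iteratedDeriv n (by exact_mod_cast ENat.natCast_lt_top n)
        x).hasDerivAt
    rw [hnonpos (n + 1) x hx]
    exact h1.hasDerivWithinAt.congr (fun y hy => hnonpos n y hy) (hnonpos n x hx)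
  refine ⟨F 0, contDiff_of_hasDerivAt_succ (fun n x => ?_) 0, fun s => ?_⟩
  · rcases lt_trichotomy x 0 with hx | rfl | hx
    · exact (hneg n x hx.le).hasDerivAt (Iic_mem_nhds hx)
    · have := (hneg n 0 le_rfl).union (hpos n 0 le_rfl)
      rwa [Iic_union_Ici, hasDerivWithinAt_univ] at this
    · exact (hpos n x hx.le).hasDerivAt (Ici_mem_nhds hx)
  · have : F 0 (s ^ 2) = f (√(s ^ 2)) := if_pos (sq_nonneg s)
    rw [this, Real.sqrt_sq_eq_abs]
    rcases abs_choice s with h | h <;> rw [h]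
    exact (he s).symm

theorem ContDiff.exists_implicit_eventually_contDiffAt {f : ℝ × ℝ → ℝ} (hf : ContDiff ℝ ∞ f)
    {a b c : ℝ} (hc : c ≠ 0) (hd : HasDerivAt (fun y => f (a, y)) c b) :
    ∃ g : ℝ → ℝ, ∀ᶠ x in 𝓝 a, ContDiffAt ℝ ∞ g x ∧ f (x, g x) = f (a, b) := by
  have hinv : ∀ p, fderiv ℝ f p (0, 1) ≠ 0 →
      (fderiv ℝ f p ∘L .inr ℝ ℝ ℝ).IsInvertible := fun p hp =>
    ⟨ContinuousLinearEquiv.unitsEquivAut ℝ (Units.mk0 _ hp), by ext; simp⟩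
  have hab : fderiv ℝ f (a, b) (0, 1) ≠ 0 := by
    have h1 := (hf.differentiable (by simp) (a, b)).hasFDerivAt.comp_hasDerivAt b
      ((hasDerivAt_const b a).prodMk (hasDerivAt_id b))
    rwa [h1.unique hd]
  have hfa : ∀ p, ContDiffAt ℝ ∞ f p := fun p => hf.contDiffAt
  have hn : (∞ : ℕ∞ω) ≠ 0 := by simp
  let g := (hfa (a, b)).implicitFunction hn (hinv _ hab)
  have hg1 : ∀ᶠ x in 𝓝 a, ContDiffAt ℝ 1 g x :=
    (((hfa (a, b)).contDiffAt_implicitFunction hn (hinv _ hab)).of_le (by simp)).eventually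
      (by simp)
  have hgf : ∀ᶠ x in 𝓝 a, f (x, g x) = f (a, b) :=
    (hfa (a, b)).eventually_apply_implicitFunction hn (hinv _ hab)
  have hga : g a = b := (hfa (a, b)).implicitFunction_apply_self hn (hinv _ hab)
  have hne : ∀ᶠ x in 𝓝 a, fderiv ℝ f (x, g x) (0, 1) ≠ 0 := by
    have h1 : Continuous fun p => fderiv ℝ f p (0, 1) :=
      (hf.continuous_fderiv (by simp)).clm_apply continuous_const
    have h2 : ContinuousAt (fun x => fderiv ℝ f (x, g x) (0, 1)) a :=
      h1.continuousAt.comp (continuousAt_id.prodMk hg1.self_of_nhds.continuousAt)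
    exact h2.eventually_ne (by rwa [hga])
  refine ⟨g, ?_⟩
  filter_upwards [hg1, hgf, hne, hgf.eventually_nhds] with x h1 h2 h3 h4
  refine ⟨?_, h2⟩
  refine ((hfa (x, g x)).contDiffAt_implicitFunction hn (hinv _ h3)).congr_of_eventuallyEq ?_
  have h5 : Tendsto (fun y => (y, g y)) (𝓝 x) (𝓝 (x, g x)) :=
    continuousAt_id.prodMk h1.continuousAt
  filter_upwards [h5.eventually
    ((hfa (x, g x)).eventually_apply_eq_iff_implicitFunction hn (hinv _ h3)), h4] with y h6 h7
  exact (h6.1 (h7.trans h2.symm)).symm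

theorem ContDiffOn.exists_contDiff_eventuallyEq {W : Set (ℝ × ℝ)} {f : ℝ × ℝ → ℝ} {p : ℝ × ℝ}
    (hf : ContDiffOn ℝ ∞ f W) (hW : IsOpen W) (hp : p ∈ W) :
    ∃ g : ℝ × ℝ → ℝ, ContDiff ℝ ∞ g ∧ g =ᶠ[𝓝 p] f := by
  obtain ⟨r, hr, hrW⟩ := Metric.nhds_basis_closedBall.mem_iff.1 (hW.mem_nhds hp)
  let χ : ContDiffBump p := ⟨r / 2, r, by positivity, by linarith⟩
  refine ⟨fun q => χ q * f q, contDiff_iff_contDiffAt.2 fun q => ?_, ?_⟩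
  · by_cases hq : q ∈ W
    · exact χ.contDiff.contDiffAt.mul (hf.contDiffAt (hW.mem_nhds hq))
    · have hq' : q ∉ tsupport χ := fun h => hq (hrW (by rwa [χ.tsupport_eq] at h))
      refine (contDiffAt_const (c := (0 : ℝ))).congr_of_eventuallyEq ?_
      filter_upwards [notMem_tsupport_iff_eventuallyEq.1 hq'] with y hy
      simp [hy]
  · filter_upwards [χ.eventuallyEq_one] with q hq
    simp [hq]

/-- The integral over one side of the bisection, after rescaling the variable. -/
theorem integral_zero_mul_sub_eq (H : ℝ × ℝ → ℝ) (x y : ℝ) :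
    ∫ θ in (0 : ℝ)..y, H (x, θ) * (θ ^ 2 - x) =
      y * ∫ u in (0 : ℝ)..1, H (x, y * u) * ((y * u) ^ 2 - x) := by
  have := intervalIntegral.mul_integral_comp_mul_left
    (f := fun θ => H (x, θ) * (θ ^ 2 - x)) (a := 0) (b := 1) y
  rw [this, mul_zero, mul_one]

theorem exists_bisecting_of_contDiff {H : ℝ × ℝ → ℝ} (hH : ContDiff ℝ ∞ H) (h0 : H (0, 0) ≠ 0) :
    ∃ g : ℝ → ℝ, ∀ᶠ x in 𝓝 (0 : ℝ), ContDiffAt ℝ ∞ g x ∧ (0 ≤ x →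
      ∫ θ in (-√x)..(x * g x), H (x, θ) * (θ ^ 2 - x) =
        ∫ θ in (x * g x)..(√x), H (x, θ) * (θ ^ 2 - x)) := by
  let K : ℝ → ℝ := fun s => ∫ u in (0 : ℝ)..1, H (s ^ 2, s * u) * (u ^ 2 - 1)
  have hK : ContDiff ℝ ∞ K := contDiff_parametric_intervalIntegral
    (f := fun p : ℝ × ℝ => H (p.1 ^ 2, p.1 * p.2) * (p.2 ^ 2 - 1)) (by fun_prop) 0 1
  obtain ⟨E, hE, hEe, hKE⟩ := ContDiff.exists_even_eq_mul_of_odd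
    (f := fun s => K s - K (-s)) (hK.sub (hK.comp contDiff_neg)) (fun s => by simp)
  obtain ⟨e, he, hEe⟩ := hE.exists_eq_comp_sq_of_even hEe
  let Φ : ℝ × ℝ → ℝ := fun p =>
    ∫ u in (0 : ℝ)..1, p.2 * (H (p.1, p.1 * p.2 * u) * (p.1 * (p.2 * u) ^ 2 - 1))
  have hΦ : ContDiff ℝ ∞ Φ := contDiff_parametric_intervalIntegral
    (f := fun q : (ℝ × ℝ) × ℝ =>
      q.1.2 * (H (q.1.1, q.1.1 * q.1.2 * q.2) * (q.1.1 * (q.1.2 * q.2) ^ 2 - 1)))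
    (by fun_prop) 0 1
  have hΨ : ContDiff ℝ ∞ fun p : ℝ × ℝ => 2 * Φ p - e p.1 := by fun_prop
  have hΨ0 : ∀ y, 2 * Φ (0, y) - e 0 = -(2 * H (0, 0)) * y - e 0 := fun y => by
    simp [Φ]; ring
  obtain ⟨g, hg⟩ := hΨ.exists_implicit_eventually_contDiffAt (a := 0)
    (b := -e 0 / (2 * H (0, 0))) (c := -(2 * H (0, 0))) (by simpa using h0) (by
      simp only [hΨ0]
      simpa using ((hasDerivAt_id _).const_mul (-(2 * H (0, 0)))).sub_const (e 0))
  refine ⟨g, hg.mono fun x hx => ⟨hx.1, fun hx0 => ?_⟩⟩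
  have hx2 : 2 * Φ (x, g x) = e x := by
    have h1 := hx.2
    simp only [hΨ0] at h1
    have : -(2 * H (0, 0)) * (-e 0 / (2 * H (0, 0))) - e 0 = 0 := by field_simp; ring
    linarith
  have hi : ∀ a b, IntervalIntegrable (fun θ => H (x, θ) * (θ ^ 2 - x)) MeasureTheory.volume a b :=
    fun a b => (by fun_prop : Continuous fun θ => H (x, θ) * (θ ^ 2 - x)).intervalIntegrable a b
  have hs : √x ^ 2 = x := Real.sq_sqrt hx0
  have hside : ∀ s, s ^ 2 = x → ∫ θ in (0 : ℝ)..s, H (x, θ) * (θ ^ 2 - x) = s * (x * K s) := by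
    intro s hs
    rw [integral_zero_mul_sub_eq, ← intervalIntegral.integral_const_mul x]
    congr 2
    funext u
    rw [hs, mul_pow, hs]
    ring
  have hmid : ∫ θ in (0 : ℝ)..(x * g x), H (x, θ) * (θ ^ 2 - x) = x ^ 2 * Φ (x, g x) := by
    rw [integral_zero_mul_sub_eq, ← intervalIntegral.integral_const_mul,
      ← intervalIntegral.integral_const_mul]
    congr 1
    ext u
    ring
  rw [← intervalIntegral.integral_interval_sub_left (hi 0 (x * g x)) (hi 0 (-√x)),
    ← intervalIntegral.integral_interval_sub_left (hi 0 (√x)) (hi 0 (x * g x)), hmid,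
    hside _ hs, hside (-√x) (by rw [neg_sq, hs])]
  have h1 : K √x - K (-√x) = √x * e x := by rw [hKE, hEe, hs]
  linear_combination x ^ 2 * hx2 - √x * x * h1 - x * e x * hs

/-- (Lemma 3.1 of the paper: the bisecting curve.) If `h` is smooth near
`(0,0)` in `ℝ²` with `h(0,0) ≠ 0`, then there is a smooth function `g` near `0 ∈ ℝ` such that
for all sufficiently small `x ≥ 0` the curve `θ = x·g(x)` bisects the integral of
`β = h(x,θ)(θ² − x) dθ` between the two branches `θ = ±√x` of `N = {θ² = x}`. -/
theorem bisecting_curve_exists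
    (W : Set (ℝ × ℝ)) (hW : IsOpen W) (h0W : ((0:ℝ), (0:ℝ)) ∈ W)
    (h : ℝ → ℝ → ℝ)
    (hsmooth : ContDiffOn ℝ (⊤ : ℕ∞) (fun p : ℝ × ℝ => h p.1 p.2) W)
    (hne : h 0 0 ≠ 0) :
    ∃ (g : ℝ → ℝ) (ε : ℝ), 0 < ε ∧
      ContDiffOn ℝ (⊤ : ℕ∞) g (Set.Ioo (-ε) ε) ∧
      ∀ x : ℝ, 0 ≤ x → x < ε →
        (∫ θ in (-Real.sqrt x)..(x * g x), h x θ * (θ ^ 2 - x))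
          = ∫ θ in (x * g x)..(Real.sqrt x), h x θ * (θ ^ 2 - x) := by
  obtain ⟨H, hH, hHh⟩ := hsmooth.exists_contDiff_eventuallyEq hW h0W
  obtain ⟨g, hg⟩ := exists_bisecting_of_contDiff hH (by rwa [hHh.self_of_nhds])
  obtain ⟨r, hr, hrH⟩ := Metric.eventually_nhds_iff_ball.1 hHh
  have hgc : ContinuousAt (fun x => x * g x) 0 :=
    continuousAt_id.mul hg.self_of_nhds.1.continuousAt
  have h1 : ∀ᶠ x in 𝓝 (0 : ℝ), |x * g x| < r :=
    hgc.abs.eventually_lt continuousAt_const (by simpa using hr)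
  have h2 : ∀ᶠ x in 𝓝 (0 : ℝ), √x < r :=
    Real.continuous_sqrt.continuousAt.eventually_lt continuousAt_const (by simpa using hr)
  have h3 : ∀ᶠ x in 𝓝 (0 : ℝ), |x| < r :=
    continuous_abs.continuousAt.eventually_lt continuousAt_const (by simpa using hr)
  obtain ⟨ε, hε, hall⟩ := Metric.eventually_nhds_iff.1 (hg.and (h1.and (h2.and h3)))
  simp only [Real.dist_eq, sub_zero] at hall
  refine ⟨g, ε, hε, fun x hx => (hall (abs_lt.2 hx)).1.1.contDiffWithinAt, fun x hx0 hxε => ?_⟩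
  obtain ⟨⟨-, hbis⟩, hx1, hx2, hx3⟩ := hall (by rwa [abs_of_nonneg hx0])
  have hcongr : ∀ a b, |a| < r → |b| < r →
      ∫ θ in a..b, h x θ * (θ ^ 2 - x) = ∫ θ in a..b, H (x, θ) * (θ ^ 2 - x) := by
    intro a b ha hb
    refine intervalIntegral.integral_congr fun θ hθ => ?_
    have hθr : |θ| < r := abs_lt.2 (ordConnected_Ioo.uIcc_subset (abs_lt.1 ha) (abs_lt.1 hb) hθ)
    have := hrH (x, θ) (by simp [Prod.dist_eq, hx3, hθr])
    simp only [this]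
  have hsr : |√x| < r := by rwa [abs_of_nonneg (Real.sqrt_nonneg x)]
  rw [hcongr _ _ (by rwa [abs_neg]) hx1, hcongr _ _ hx1 hsr]
  exact hbis hx0
end

section
/- Let h be a smooth real-valued function on a neighborhood of (0,0) in ℝ² (variables (x, θ)) with h(0,0) > 0, and assume the symmetry condition ∫_{−√x}^{0} h(x,θ)(θ² − x) dθ = ∫_{0}^{√x} h(x,θ)(θ² − x) dθ holds for all sufficiently small x ≥ 0. Then there exists a smooth function y on a neighborhood of 0 in ℝ with y(0) = 0 and y'(0) > 0 such that for all sufficiently small x ≥ 0: ∫_{0}^{√x} h(x,θ)(θ² − x) dθ = −(2/3)·y(x)^{3/2}. -/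
open scoped Topology

/-- A smooth function on `ℝ` with a single prescribed nonzero derivative at the origin, whose
lower order derivatives are uniformly small. -/
theorem exists_contDiff_iteratedDeriv_eq_ite (n : ℕ) (a ε : ℝ) (hε : 0 < ε) :
    ∃ f : ℝ → ℝ, ContDiff ℝ (⊤ : ℕ∞) f ∧
      (∀ k < n, ∀ x, ‖iteratedDeriv k f x‖ ≤ ε) ∧
      (∀ k, ∃ M, ∀ x, ‖iteratedDeriv k f x‖ ≤ M) ∧
      ∀ k, iteratedDeriv k f 0 = if k = n then a else 0 := by
  let χ : ContDiffBump (0 : ℝ) := default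
  let ψ : ℝ → ℝ := fun x => χ x * x ^ n
  have hψ : ContDiff ℝ (⊤ : ℕ∞) ψ := χ.contDiff.mul (contDiff_id.pow n)
  have hψc : HasCompactSupport ψ := χ.hasCompactSupport.mul_right
  have hb : ∀ k, ∃ M, ∀ x, ‖iteratedDeriv k ψ x‖ ≤ M := fun k => by
    have h1 : Continuous (fun x => iteratedFDeriv ℝ k ψ x) :=
      hψ.continuous_iteratedFDeriv (mod_cast le_top)
    obtain ⟨M, hM⟩ := h1.bounded_above_of_compact_support (hψc.iteratedFDeriv k)
    exact ⟨M, fun x => by rw [← norm_iteratedFDeriv_eq_norm_iteratedDeriv]; exact hM x⟩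
  choose C hC using hb
  have hC0 : ∀ k, 0 ≤ C k := fun k => (norm_nonneg _).trans (hC k 0)
  have hψ0 : ∀ k, iteratedDeriv k ψ 0 = if k = n then (n.factorial : ℝ) else 0 := fun k => by
    have h1 : ψ =ᶠ[𝓝 0] fun x => x ^ n := by
      filter_upwards [χ.eventuallyEq_one] with x hx
      simp [ψ, hx]
    rw [h1.iteratedDeriv_eq k, iteratedDeriv_fun_pow_zero]
    simp [eq_comm]
  set S : ℝ := ∑ k ∈ Finset.range n, C k with hS
  have hS0 : 0 ≤ S := Finset.sum_nonneg fun k _ => hC0 k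
  set c : ℝ := a / n.factorial with hc
  set l : ℝ := 1 + |c| * S / ε with hl
  have hl1 : 1 ≤ l := by
    have : 0 ≤ |c| * S / ε := by positivity
    linarith
  have hl0 : 0 < l := by linarith
  have hd : ∀ k x, iteratedDeriv k (fun x => c * (l ^ n)⁻¹ * ψ (l * x)) x
      = c * (l ^ n)⁻¹ * (l ^ k * iteratedDeriv k ψ (l * x)) := fun k x => by
    rw [iteratedDeriv_const_mul_field,
      iteratedDeriv_comp_const_mul (hψ.of_le (mod_cast le_top)) l]
  refine ⟨fun x => c * (l ^ n)⁻¹ * ψ (l * x), ?_, fun k hk x => ?_, fun k => ?_, fun k => ?_⟩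
  · exact contDiff_const.mul (hψ.comp (contDiff_const.mul contDiff_id))
  · rw [hd]
    have h1 : ‖iteratedDeriv k ψ (l * x)‖ ≤ S :=
      (hC k _).trans (Finset.single_le_sum (fun k _ => hC0 k) (Finset.mem_range.2 hk))
    have h2 : (l ^ n)⁻¹ * l ^ k ≤ l⁻¹ := by
      rw [inv_mul_le_iff₀ (by positivity), ← div_eq_mul_inv, le_div_iff₀ hl0, ← pow_succ]
      exact pow_le_pow_right₀ hl1 hk
    calc ‖c * (l ^ n)⁻¹ * (l ^ k * iteratedDeriv k ψ (l * x))‖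
        = |c| * ((l ^ n)⁻¹ * l ^ k) * ‖iteratedDeriv k ψ (l * x)‖ := by
          rw [norm_mul, norm_mul, norm_mul, Real.norm_eq_abs, Real.norm_of_nonneg (by positivity),
            Real.norm_of_nonneg (by positivity : 0 ≤ l ^ k)]
          ring
      _ ≤ |c| * l⁻¹ * S := by gcongr
      _ ≤ ε := by
          have : |c| * S ≤ ε * l := by
            rw [hl, mul_add, mul_div_cancel₀ _ hε.ne']
            linarith
          rw [mul_right_comm, ← div_eq_mul_inv, div_le_iff₀ hl0]
          exact this
  · refine ⟨‖c * (l ^ n)⁻¹‖ * (‖l ^ k‖ * C k), fun x => ?_⟩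
    rw [hd, norm_mul, norm_mul (l ^ k)]
    gcongr
    exact hC k _
  · rw [hd, mul_zero, hψ0]
    split_ifs with h
    · subst h
      have := Nat.factorial_ne_zero k
      rw [hc]
      field_simp
    · simp

/-- **Borel's lemma**: every real sequence is the sequence of derivatives at the origin of a
smooth function on `ℝ`. -/
theorem exists_contDiff_iteratedDeriv_zero_eq (a : ℕ → ℝ) :
    ∃ f : ℝ → ℝ, ContDiff ℝ (⊤ : ℕ∞) f ∧ ∀ k, iteratedDeriv k f 0 = a k := by
  choose f hf hsmall hbdd hval using fun n =>
    exists_contDiff_iteratedDeriv_eq_ite n (a n) ((1 / 2) ^ n) (by positivity)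
  choose M hM using hbdd
  let v : ℕ → ℕ → ℝ := fun k n => if k < n then (1 / 2) ^ n else M n k
  have hv : ∀ k : ℕ, (k : ℕ∞) ≤ ⊤ → Summable (v k) := fun k _ => by
    refine (summable_congr_cofinite (g := fun n : ℕ => ((1 / 2 : ℝ)) ^ n) ?_).2
      summable_geometric_two
    rw [Nat.cofinite_eq_atTop]
    filter_upwards [Filter.eventually_gt_atTop k] with n hn
    simp [v, hn]
  have hle : ∀ (k n : ℕ) (x : ℝ), (k : ℕ∞) ≤ ⊤ → ‖iteratedFDeriv ℝ k (f n) x‖ ≤ v k n :=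
    fun k n x _ => by
      rw [norm_iteratedFDeriv_eq_norm_iteratedDeriv]
      by_cases h : k < n
      · simpa [v, h] using hsmall n k h x
      · simpa [v, h] using hM n k x
  refine ⟨fun x => ∑' n, f n x, contDiff_tsum hf hv hle, fun k => ?_⟩
  have hs : Summable fun n => iteratedFDeriv ℝ k (f n) 0 :=
    .of_norm_bounded (hv k le_top) fun n => hle k n 0 le_top
  rw [iteratedDeriv_eq_iteratedFDeriv, iteratedFDeriv_tsum_apply hf hv hle le_top,
    ContinuousMultilinearMap.tsum_eval hs]
  simp_rw [← iteratedDeriv_eq_iteratedFDeriv, hval]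
  simp

/-- The integral over a fixed interval of a smooth function of two variables is a smooth function
of the remaining variable. -/
theorem ContDiff.intervalIntegral_right {F : ℝ → ℝ → ℝ} (a b : ℝ)
    (hF : ContDiff ℝ (⊤ : ℕ∞) (fun p : ℝ × ℝ => F p.1 p.2)) :
    ContDiff ℝ (⊤ : ℕ∞) fun x => ∫ t in a..b, F x t := by
  rw [contDiff_infty]
  intro n
  induction n generalizing F with
  | zero =>
    rw [Nat.cast_zero, contDiff_zero]
    exact intervalIntegral.continuous_parametric_intervalIntegral_of_continuous'
      (f := F) hF.continuous a b
  | succ n ih =>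
    let F' : ℝ → ℝ → ℝ := fun x t => fderiv ℝ (fun p : ℝ × ℝ => F p.1 p.2) (x, t) (1, 0)
    have hF' : ContDiff ℝ (⊤ : ℕ∞) (fun p : ℝ × ℝ => F' p.1 p.2) :=
      (hF.fderiv_right (m := (⊤ : ℕ∞)) (by simp)).clm_apply contDiff_const
    have hd : ∀ x t, HasDerivAt (fun x => F x t) (F' x t) x := fun x t => by
      have h1 : HasFDerivAt (fun p : ℝ × ℝ => F p.1 p.2)
          (fderiv ℝ (fun p : ℝ × ℝ => F p.1 p.2) (x, t)) (x, t) :=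
        (hF.differentiable (by simp) _).hasFDerivAt
      exact h1.comp_hasDerivAt x ((hasDerivAt_id x).prodMk (hasDerivAt_const x t))
    have hFc : ∀ x, Continuous (F x) := fun x =>
      hF.continuous.comp (by fun_prop : Continuous fun t : ℝ => (x, t))
    have hFc' : ∀ x, Continuous (F' x) := fun x =>
      hF'.continuous.comp (by fun_prop : Continuous fun t : ℝ => (x, t))
    have hI : ∀ x, HasDerivAt (fun x => ∫ t in a..b, F x t) (∫ t in a..b, F' x t) x := fun x => by
      obtain ⟨M, hM⟩ := ((isCompact_closedBall x 1).prod
        (isCompact_uIcc (a := a) (b := b))).exists_bound_of_continuousOn hF'.continuous.continuousOn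
      refine (intervalIntegral.hasDerivAt_integral_of_dominated_loc_of_deriv_le
        (bound := fun _ => M) (Metric.closedBall_mem_nhds x one_pos)
        (.of_forall fun y => (hFc y).aestronglyMeasurable) ((hFc x).intervalIntegrable _ _)
        (hFc' x).aestronglyMeasurable (.of_forall fun t ht y hy => ?_)
        intervalIntegrable_const (.of_forall fun t _ y _ => hd y t)).2
      exact hM (y, t) ⟨hy, Set.uIoc_subset_uIcc ht⟩
    rw [Nat.cast_succ, contDiff_succ_iff_deriv]
    refine ⟨fun x => (hI x).differentiableAt, by simp, ?_⟩
    rw [funext fun x => (hI x).deriv]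
    exact ih hF'

/-- For an even smooth function `f`, the quotient `f' s / (2 s)` extends to an even smooth
function. -/
theorem exists_contDiff_deriv_eq_of_even {f : ℝ → ℝ} (hf : ContDiff ℝ (⊤ : ℕ∞) f)
    (heven : ∀ s, f (-s) = f s) :
    ∃ g : ℝ → ℝ, ContDiff ℝ (⊤ : ℕ∞) g ∧ (∀ s, g (-s) = g s) ∧ ∀ s, deriv f s = 2 * s * g s := by
  have hf1 : ContDiff ℝ (⊤ : ℕ∞) (deriv f) := hf.deriv'
  have hf2 : ContDiff ℝ (⊤ : ℕ∞) (deriv (deriv f)) := hf1.deriv'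
  have hodd : ∀ s, deriv f (-s) = -deriv f s := fun s => by
    have := deriv_comp_neg f s
    rw [funext heven] at this
    linarith
  have heven2 : ∀ s, deriv (deriv f) (-s) = deriv (deriv f) s := fun s => by
    have := deriv_comp_neg (deriv f) s
    rw [funext hodd, deriv.fun_neg] at this
    linarith
  refine ⟨fun s => 1 / 2 * ∫ t in (0:ℝ)..1, deriv (deriv f) (s * t), ?_, fun s => ?_, fun s => ?_⟩
  · exact contDiff_const.mul (ContDiff.intervalIntegral_right 0 1
      (hf2.comp (contDiff_fst.mul contDiff_snd)))
  · simp [neg_mul, heven2]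
  · have h0 : deriv f 0 = 0 := by have := hodd 0; rw [neg_zero] at this; linarith
    have h1 := intervalIntegral.mul_integral_comp_mul_left (a := 0) (b := 1) (f := deriv (deriv f)) s
    rw [mul_zero, mul_one, intervalIntegral.integral_deriv_eq_sub
      (fun x _ => hf1.differentiable (by simp) x)
      (hf2.continuous.intervalIntegrable _ _), h0, sub_zero] at h1
    linear_combination -h1

/-- **Whitney's theorem on even functions**: an even smooth function of `s` is a smooth function
of `s ^ 2`. -/
theorem exists_contDiff_comp_sq_of_even {f : ℝ → ℝ} (hf : ContDiff ℝ (⊤ : ℕ∞) f)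
    (heven : ∀ s, f (-s) = f s) :
    ∃ g : ℝ → ℝ, ContDiff ℝ (⊤ : ℕ∞) g ∧ ∀ s, f s = g (s ^ 2) := by
  choose! D hD using fun (f : ℝ → ℝ) (hf : ContDiff ℝ (⊤ : ℕ∞) f ∧ ∀ s, f (-s) = f s) =>
    exists_contDiff_deriv_eq_of_even hf.1 hf.2
  have hp : ∀ n, ContDiff ℝ (⊤ : ℕ∞) (D^[n] f) ∧ ∀ s, (D^[n] f) (-s) = (D^[n] f) s := fun n => by
    induction n with
    | zero => exact ⟨hf, heven⟩
    | succ n ih =>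
      rw [Function.iterate_succ_apply']
      exact ⟨(hD _ ih).1, (hD _ ih).2.1⟩
  have hderiv : ∀ n s, HasDerivAt (D^[n] f) (2 * s * (D^[n + 1] f) s) s := fun n s => by
    rw [Function.iterate_succ_apply', ← (hD _ (hp n)).2.2 s]
    exact ((hp n).1.differentiable (by simp) s).hasDerivAt
  obtain ⟨φ, hφ, hφ0⟩ := exists_contDiff_iteratedDeriv_zero_eq fun n => (D^[n] f) 0
  let g : ℕ → ℝ → ℝ := fun n x => if x ≤ 0 then iteratedDeriv n φ x else (D^[n] f) (√x)
  have hφc : ∀ n, Continuous (iteratedDeriv n φ) := fun n =>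
    hφ.continuous_iteratedDeriv n (mod_cast le_top)
  have hgc : ∀ n, Continuous (g n) := fun n =>
    Continuous.if_le (hφc n) ((hp n).1.continuous.comp Real.continuous_sqrt)
      continuous_id continuous_const (by rintro x rfl; simp [hφ0])
  have hg : ∀ n x, HasDerivAt (g n) (g (n + 1) x) x := fun n x => by
    suffices H : ∀ y ≠ 0, HasDerivAt (g n) (g (n + 1) y) y from
      hasDerivAt_of_hasDerivAt_of_ne' H (hgc n).continuousAt (hgc (n + 1)).continuousAt x
    intro y hy
    rcases hy.lt_or_gt with hy | hy
    · have h1 : g n =ᶠ[𝓝 y] iteratedDeriv n φ := by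
        filter_upwards [Iio_mem_nhds hy] with x hx
        simp [g, (Set.mem_Iio.1 hx).le]
      have h2 : g (n + 1) y = deriv (iteratedDeriv n φ) y := by
        simp [g, hy.le, iteratedDeriv_succ]
      rw [h2]
      exact (hφ.differentiable_iteratedDeriv n
        (mod_cast WithTop.coe_lt_top _) y).hasDerivAt.congr_of_eventuallyEq h1
    · have h1 : g n =ᶠ[𝓝 y] fun x => (D^[n] f) (√x) := by
        filter_upwards [Ioi_mem_nhds hy] with x hx
        simp [g, (Set.mem_Ioi.1 hx).not_ge]
      refine HasDerivAt.congr_of_eventuallyEq ?_ h1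
      refine ((hderiv n (√y)).comp y (Real.hasDerivAt_sqrt hy.ne')).congr_deriv ?_
      have := Real.sqrt_pos.2 hy
      rw [show g (n + 1) y = (D^[n + 1] f) (√y) from if_neg hy.not_ge]
      field_simp
  refine ⟨g 0, ?_, fun s => ?_⟩
  · rw [contDiff_infty]
    intro m
    suffices H : ∀ n, ContDiff ℝ m (g n) from H 0
    intro n
    induction m generalizing n with
    | zero => exact contDiff_zero.2 (hgc n)
    | succ m ih =>
      rw [Nat.cast_succ, contDiff_succ_iff_deriv]
      refine ⟨fun x => (hg n x).differentiableAt, by simp, ?_⟩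
      rw [funext fun x => (hg n x).deriv]
      exact ih (n + 1)
  · by_cases hs : s = 0
    · have := hφ0 0
      simp_all [g]
    · have : ¬ s ^ 2 ≤ 0 := (by positivity : 0 < s ^ 2).not_ge
      rw [show g 0 (s ^ 2) = f (√(s ^ 2)) from if_neg this, Real.sqrt_sq_eq_abs]
      rcases abs_choice s with h | h <;> simp [h, heven]

/-- Multiplying by a cutoff, a function smooth near the origin of the plane agrees near the origin
with a function smooth on the whole plane. -/
theorem exists_contDiff_eq_on_ball {W : Set (ℝ × ℝ)} (hW : IsOpen W) (h0W : ((0:ℝ), (0:ℝ)) ∈ W)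
    {h : ℝ → ℝ → ℝ} (hsmooth : ContDiffOn ℝ (⊤ : ℕ∞) (fun p : ℝ × ℝ => h p.1 p.2) W) :
    ∃ H : ℝ → ℝ → ℝ, ContDiff ℝ (⊤ : ℕ∞) (fun p : ℝ × ℝ => H p.1 p.2) ∧
      ∃ r > 0, ∀ x t, |x| < r → |t| < r → H x t = h x t := by
  obtain ⟨R, hR, hRW⟩ := Metric.nhds_basis_closedBall.mem_iff.1 (hW.mem_nhds h0W)
  let χ : ContDiffBump ((0:ℝ), (0:ℝ)) := ⟨R / 2, R, half_pos hR, half_lt_self hR⟩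
  refine ⟨fun x t => χ (x, t) * h x t, contDiff_iff_contDiffAt.2 fun p => ?_, R / 2, half_pos hR,
    fun x t hx ht => ?_⟩
  · by_cases hp : p ∈ W
    · exact χ.contDiff.contDiffAt.mul (hsmooth.contDiffAt (hW.mem_nhds hp))
    · have h1 : p ∉ tsupport χ := fun h => hp (hRW (by rwa [χ.tsupport_eq] at h))
      refine (contDiffAt_const (c := (0:ℝ))).congr_of_eventuallyEq ?_
      filter_upwards [notMem_tsupport_iff_eventuallyEq.1 h1] with q hq
      have hq' : χ (q.1, q.2) = 0 := hq
      rw [hq', zero_mul]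
  · have : χ (x, t) = 1 := χ.one_of_mem_closedBall (by
      rw [Metric.mem_closedBall, Prod.dist_eq, Real.dist_eq, Real.dist_eq, sub_zero, sub_zero]
      exact max_le hx.le ht.le)
    simp [this]

/-- For `H` smooth, the integral of `H x θ * (θ ^ 2 - x)` over `[-√x, √x]` is `(√x) ^ 3` times a
smooth function of `x`. -/
theorem exists_contDiff_integral_eq_sqrt_pow_mul {H : ℝ → ℝ → ℝ}
    (hH : ContDiff ℝ (⊤ : ℕ∞) (fun p : ℝ × ℝ => H p.1 p.2)) :
    ∃ g : ℝ → ℝ, ContDiff ℝ (⊤ : ℕ∞) g ∧ g 0 = 4 / 3 * H 0 0 ∧ ∀ x, 0 ≤ x →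
      ∫ θ in (-√x)..√x, H x θ * (θ ^ 2 - x) = -(√x ^ 3 * g x) := by
  let G : ℝ → ℝ := fun s => ∫ t in (-1:ℝ)..1, H (s ^ 2) (s * t) * (1 - t ^ 2)
  have hG : ContDiff ℝ (⊤ : ℕ∞) G := by
    refine ContDiff.intervalIntegral_right (-1) 1 (ContDiff.mul ?_ ?_)
    · exact hH.comp ((contDiff_fst.pow 2).prodMk (contDiff_fst.mul contDiff_snd))
    · exact contDiff_const.sub (contDiff_snd.pow 2)
  have hGe : ∀ s, G (-s) = G s := fun s => by
    have := intervalIntegral.integral_comp_neg (a := -1) (b := 1)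
      (fun t => H (s ^ 2) (s * t) * (1 - t ^ 2))
    simpa [G] using this
  obtain ⟨g, hg, hGg⟩ := exists_contDiff_comp_sq_of_even hG hGe
  refine ⟨g, hg, ?_, fun x hx => ?_⟩
  · have h0 := hGg 0
    rw [zero_pow two_ne_zero] at h0
    rw [← h0]
    simp only [G, zero_mul, zero_pow two_ne_zero, intervalIntegral.integral_const_mul]
    rw [intervalIntegral.integral_sub (by simp) ((continuous_pow 2).intervalIntegrable _ _),
      integral_pow]
    norm_num
    ring
  · have h1 := hGg (√x)
    rw [Real.sq_sqrt hx] at h1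
    have h2 := intervalIntegral.mul_integral_comp_mul_left (a := -1) (b := 1)
      (f := fun θ => H x θ * (θ ^ 2 - x)) (√x)
    rw [mul_neg, mul_one] at h2
    rw [← h2, ← h1]
    have h3 : ∀ t, H x (√x * t) * ((√x * t) ^ 2 - x)
        = -(√x ^ 2) * (H (√x ^ 2) (√x * t) * (1 - t ^ 2)) := fun t => by
      rw [mul_pow, Real.sq_sqrt hx]
      ring
    simp only [h3, intervalIntegral.integral_const_mul, G]
    ring

/-- (Lemma 3.2 of the paper: normalizing the base variable.) If `h` is smooth
near `(0,0)` with `h(0,0) > 0` and the integral of `β = h(x,θ)(θ² − x) dθ` is symmetric about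
`θ = 0` for small `x ≥ 0`, then there is a smooth reparametrization `y = y(x)` with `y(0) = 0`,
`y'(0) > 0`, such that `∫₀^{√x} h(x,θ)(θ² − x) dθ = −(2/3)·y(x)^{3/2}` for small `x ≥ 0`. -/
theorem base_reparametrization_exists
    (W : Set (ℝ × ℝ)) (hW : IsOpen W) (h0W : ((0:ℝ), (0:ℝ)) ∈ W)
    (h : ℝ → ℝ → ℝ)
    (hsmooth : ContDiffOn ℝ (⊤ : ℕ∞) (fun p : ℝ × ℝ => h p.1 p.2) W)
    (hpos : 0 < h 0 0)
    (δ : ℝ) (hδ : 0 < δ)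
    (hsym : ∀ x : ℝ, 0 ≤ x → x < δ →
      (∫ θ in (-Real.sqrt x)..(0:ℝ), h x θ * (θ ^ 2 - x))
        = ∫ θ in (0:ℝ)..(Real.sqrt x), h x θ * (θ ^ 2 - x)) :
    ∃ (y : ℝ → ℝ) (ε : ℝ), 0 < ε ∧
      ContDiffOn ℝ (⊤ : ℕ∞) y (Set.Ioo (-ε) ε) ∧
      y 0 = 0 ∧ 0 < deriv y 0 ∧
      ∀ x : ℝ, 0 ≤ x → x < ε →
        (∫ θ in (0:ℝ)..(Real.sqrt x), h x θ * (θ ^ 2 - x))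
          = -(2/3) * (y x) ^ ((3:ℝ)/2) := by
  obtain ⟨H, hH, r, hr, hHh⟩ := exists_contDiff_eq_on_ball hW h0W hsmooth
  obtain ⟨g, hg, hg0, hgH⟩ := exists_contDiff_integral_eq_sqrt_pow_mul hH
  rw [hHh 0 0 (by simpa using hr) (by simpa using hr)] at hg0
  have hg0pos : 0 < g 0 := by rw [hg0]; positivity
  have hev : ∀ᶠ x in 𝓝 (0:ℝ), 0 < g x ∧ |x| < r ∧ √x < r ∧ x < δ :=
    (hg.continuous.continuousAt.eventually (lt_mem_nhds hg0pos)).and <|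
      (continuous_abs.continuousAt.eventually (gt_mem_nhds (by simpa using hr))).and <|
      (Real.continuous_sqrt.continuousAt.eventually (gt_mem_nhds (by simpa using hr))).and <|
      gt_mem_nhds hδ
  obtain ⟨ε, hε, hball⟩ := Metric.eventually_nhds_iff.1 hev
  have hball : ∀ x, |x| < ε → 0 < g x ∧ |x| < r ∧ √x < r ∧ x < δ := fun x hx =>
    hball (by rwa [Real.dist_eq, sub_zero])
  let k : ℝ → ℝ := fun x => (3 / 4 * g x) ^ ((2:ℝ) / 3)
  have hk : ∀ x, 0 < g x → ContDiffAt ℝ (⊤ : ℕ∞) k x := fun x hx =>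
    (contDiff_const.mul hg).contDiffAt.rpow_const_of_ne (by positivity)
  have hderiv : HasDerivAt (fun x => x * k x) (k 0) 0 := by
    have := (hasDerivAt_id (0:ℝ)).mul ((hk 0 hg0pos).differentiableAt (by simp)).hasDerivAt
    simp only [id, one_mul, zero_mul, add_zero] at this
    exact this
  refine ⟨fun x => x * k x, ε, hε, fun x hx => ?_, zero_mul _, ?_, fun x hx0 hxε => ?_⟩
  · exact (contDiffAt_id.mul (hk x (hball x (abs_lt.2 hx)).1)).contDiffWithinAt
  · rw [hderiv.deriv]
    positivity
  · obtain ⟨hgx, hxr, hsr, hxδ⟩ := hball x (by rwa [abs_of_nonneg hx0])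
    have hs := Real.sqrt_nonneg x
    have hcongr : ∀ a b, -√x ≤ a → a ≤ b → b ≤ √x →
        ∫ θ in a..b, h x θ * (θ ^ 2 - x) = ∫ θ in a..b, H x θ * (θ ^ 2 - x) :=
      fun a b ha hab hb => intervalIntegral.integral_congr fun θ hθ => by
        rw [Set.uIcc_of_le hab] at hθ
        have : |θ| < r := (abs_le.2 ⟨ha.trans hθ.1, hθ.2.trans hb⟩).trans_lt hsr
        simp only [hHh x θ hxr this]
    have hint : ∀ a b, IntervalIntegrable (fun θ => H x θ * (θ ^ 2 - x)) MeasureTheory.volume a b :=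
      fun a b => ((hH.continuous.comp (by fun_prop : Continuous fun θ : ℝ => (x, θ))).mul
        (by fun_prop)).intervalIntegrable _ _
    have hsymH := hsym x hx0 hxδ
    have hsum := intervalIntegral.integral_add_adjacent_intervals (hint (-√x) 0) (hint 0 √x)
    rw [hcongr _ _ le_rfl (by linarith) hs, hcongr _ _ (by linarith) hs le_rfl] at hsymH
    rw [hsymH, hgH x hx0] at hsum
    have hpow : (x * k x) ^ ((3:ℝ) / 2) = √x ^ 3 * (3 / 4 * g x) := by
      rw [Real.mul_rpow hx0 (by positivity), ← Real.rpow_mul (by positivity),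
        Real.sqrt_eq_rpow, ← Real.rpow_mul_natCast hx0]
      norm_num
    rw [hcongr _ _ (by linarith) hs le_rfl, hpow]
    linarith
end

section
/- Let h be a smooth real-valued function on a neighborhood of (0,0) in ℝ² (variables (x, θ)) satisfying ∫_{0}^{√x} h(x,θ)(θ² − x) dθ = −(2/3)·x^{3/2} for all sufficiently small x ≥ 0 (which forces h(0,0) = 1). Then there exists a smooth function L on a neighborhood of 0 in ℝ such that the function ψ₀(θ) := θ + θ³·L(θ) satisfies ∫_{0}^{θ} h(0,η)·η² dη = ψ₀(θ)³ / 3 for all sufficiently small θ. -/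
open scoped Topology
open MeasureTheory Set Filter

/-- A function that is smooth on a neighborhood of a point agrees near that point with a globally
smooth function. -/
theorem exists_contDiff_eventuallyEq {E : Type*} [NormedAddCommGroup E] [NormedSpace ℝ E]
    [HasContDiffBump E] {s : Set E} (hs : IsOpen s) {x : E} (hx : x ∈ s) {f : E → ℝ}
    (hf : ContDiffOn ℝ (⊤ : ℕ∞) f s) :
    ∃ g : E → ℝ, ContDiff ℝ (⊤ : ℕ∞) g ∧ g =ᶠ[𝓝 x] f := by
  obtain ⟨r, hr, hrs⟩ := Metric.isOpen_iff.1 hs x hx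
  let χ : ContDiffBump x := ⟨r / 4, r / 2, by linarith, by linarith⟩
  refine ⟨fun y => χ y * f y, contDiff_iff_contDiffAt.2 fun y => ?_, ?_⟩
  · by_cases hy : dist y x < r
    · exact χ.contDiff.contDiffAt.mul (hf.contDiffAt (hs.mem_nhds (hrs hy)))
    · have hfar : {z | r / 2 < dist z x} ∈ 𝓝 y :=
        (isOpen_lt continuous_const (continuous_id.dist continuous_const)).mem_nhds (by
          simp only [mem_ofPred_eq, id_eq]; linarith)
      refine (contDiffAt_const (c := (0 : ℝ))).congr_of_eventuallyEq ?_
      filter_upwards [hfar] with z hz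
      rw [χ.zero_of_le_dist (le_of_lt hz), zero_mul]
  · filter_upwards [χ.eventuallyEq_one] with y hy
    simp [hy]

/-- Differentiation under the integral sign over a bounded interval. -/
theorem hasDerivAt_intervalIntegral_of_continuous {F F' : ℝ → ℝ → ℝ} {a b : ℝ}
    (hF : Continuous (Function.uncurry F)) (hF' : Continuous (Function.uncurry F'))
    (hderiv : ∀ x s, HasDerivAt (fun y => F y s) (F' x s) x) (x : ℝ) :
    HasDerivAt (fun y => ∫ s in a..b, F y s) (∫ s in a..b, F' x s) x := by
  obtain ⟨C, hC⟩ := ((isCompact_closedBall x 1).prod (isCompact_uIcc (a := a) (b := b))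
    ).exists_bound_of_continuousOn hF'.continuousOn
  have hcont : ∀ y, Continuous (F y) := fun y => hF.comp (by fun_prop : Continuous fun s => (y, s))
  have hcont' : Continuous (F' x) := hF'.comp (by fun_prop : Continuous fun s => (x, s))
  refine (intervalIntegral.hasDerivAt_integral_of_dominated_loc_of_deriv_le
    (bound := fun _ => C) (Metric.closedBall_mem_nhds x one_pos)
    (Eventually.of_forall fun y => (hcont y).aestronglyMeasurable)
    ((hcont x).intervalIntegrable a b) hcont'.aestronglyMeasurable ?_ ?_ ?_).2
  · exact Eventually.of_forall fun s hs y hy => hC (y, s) ⟨hy, uIoc_subset_uIcc hs⟩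
  · exact intervalIntegrable_const
  · exact Eventually.of_forall fun s _ y _ => hderiv y s

theorem hasDerivAt_integral_comp_mul_mul_pow {f : ℝ → ℝ} (hf : ContDiff ℝ 1 f) (k : ℕ) (x : ℝ) :
    HasDerivAt (fun y => ∫ s in (0 : ℝ)..1, f (s * y) * s ^ k)
      (∫ s in (0 : ℝ)..1, deriv f (s * x) * s ^ (k + 1)) x := by
  have hc := hf.continuous
  have hc' := hf.continuous_deriv le_rfl
  refine hasDerivAt_intervalIntegral_of_continuous
    (F := fun y s => f (s * y) * s ^ k) (F' := fun y s => deriv f (s * y) * s ^ (k + 1))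
    (by simp only [Function.uncurry_def]; fun_prop)
    (by simp only [Function.uncurry_def]; fun_prop) (fun y s => ?_) x
  have hd := (hf.differentiable one_ne_zero (s * y)).hasDerivAt
  refine ((hd.comp y ((hasDerivAt_id y).const_mul s)).mul_const (s ^ k)).congr_deriv ?_
  ring

theorem contDiff_integral_comp_mul_mul_pow {f : ℝ → ℝ} (hf : ContDiff ℝ (⊤ : ℕ∞) f) (k : ℕ) :
    ContDiff ℝ (⊤ : ℕ∞) (fun x => ∫ s in (0 : ℝ)..1, f (s * x) * s ^ k) := by
  refine contDiff_infty.2 fun n => ?_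
  induction n generalizing f k with
  | zero =>
    exact contDiff_zero.2 (continuous_iff_continuousAt.2 fun x =>
      (hasDerivAt_integral_comp_mul_mul_pow (contDiff_infty.1 hf 1) k x).continuousAt)
  | succ n ih =>
    have hd := hasDerivAt_integral_comp_mul_mul_pow (contDiff_infty.1 hf 1) k
    push_cast
    refine contDiff_succ_iff_deriv.2 ⟨fun x => (hd x).differentiableAt, by simp, ?_⟩
    rw [funext fun x => (hd x).deriv]
    exact ih (contDiff_infty_iff_deriv.1 hf).2 (k + 1)

/-- Hadamard's lemma in one variable. -/
theorem exists_contDiff_eq_add_mul {f : ℝ → ℝ} (hf : ContDiff ℝ (⊤ : ℕ∞) f) :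
    ∃ g : ℝ → ℝ, ContDiff ℝ (⊤ : ℕ∞) g ∧ g 0 = deriv f 0 ∧ ∀ x, f x = f 0 + x * g x := by
  have hf' := (contDiff_infty_iff_deriv.1 hf).2
  refine ⟨fun x => ∫ s in (0 : ℝ)..1, deriv f (s * x) * s ^ 0,
    contDiff_integral_comp_mul_mul_pow hf' 0, by simp, fun x => ?_⟩
  have hsub := intervalIntegral.mul_integral_comp_mul_right (a := 0) (b := 1)
    (f := deriv f) (c := x)
  simp only [pow_zero, mul_one, zero_mul, one_mul] at hsub ⊢
  rw [hsub, intervalIntegral.integral_deriv_eq_sub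
    (fun y _ => hf.differentiable (by simp) y) (hf'.continuous.intervalIntegrable _ _)]
  ring

/-- The normalization of the folded integral determines the 1-jet of `G` along
`{x = 0}`. -/
theorem one_jet_of_integral_sq_sub_eq {G : ℝ × ℝ → ℝ} (hG : ContDiff ℝ (⊤ : ℕ∞) G) {τ : ℝ}
    (hτ : 0 < τ)
    (hnorm : ∀ t, 0 < t → t < τ →
      ∫ θ in (0 : ℝ)..t, G (t ^ 2, θ) * (θ ^ 2 - t ^ 2) = -(2 / 3) * t ^ 3) :
    G (0, 0) = 1 ∧ deriv (fun θ => G (0, θ)) 0 = 0 := by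
  let P : ℝ → ℝ := fun t => ∫ s in (0 : ℝ)..1, G (t ^ 2, s * t) * (s ^ 2 - 1)
  let P' : ℝ → ℝ := fun t =>
    ∫ s in (0 : ℝ)..1, fderiv ℝ G (t ^ 2, s * t) (2 * t, s) * (s ^ 2 - 1)
  have hGc := hG.continuous
  have hGd := hG.differentiable (by simp)
  have hGc' : Continuous (fderiv ℝ G) := hG.continuous_fderiv (by simp)
  have hP : ∀ t, HasDerivAt P (P' t) t := by
    refine hasDerivAt_intervalIntegral_of_continuous
      (F := fun t s => G (t ^ 2, s * t) * (s ^ 2 - 1))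
      (F' := fun t s => fderiv ℝ G (t ^ 2, s * t) (2 * t, s) * (s ^ 2 - 1))
      (by simp only [Function.uncurry_def]; fun_prop)
      (by simp only [Function.uncurry_def]; fun_prop) fun t s => ?_
    have hin : HasDerivAt (fun t : ℝ => (t ^ 2, s * t)) (2 * t, s) t := by
      simpa using (hasDerivAt_pow 2 t).prodMk ((hasDerivAt_id t).const_mul s)
    exact ((hGd _).hasFDerivAt.comp_hasDerivAt t hin).mul_const _
  have hPconst : ∀ t, 0 < t → t < τ → P t = -(2 / 3) := by
    intro t ht htτ
    have hsub := intervalIntegral.mul_integral_comp_mul_right (a := 0) (b := 1)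
      (f := fun θ => G (t ^ 2, θ) * (θ ^ 2 - t ^ 2)) (c := t)
    simp only [zero_mul, one_mul, hnorm t ht htτ] at hsub
    have hscale : ∀ s : ℝ, G (t ^ 2, s * t) * ((s * t) ^ 2 - t ^ 2) =
        t ^ 2 * (G (t ^ 2, s * t) * (s ^ 2 - 1)) := fun s => by ring
    simp only [hscale, intervalIntegral.integral_const_mul] at hsub
    have ht3 : t ^ 3 ≠ 0 := by positivity
    apply mul_left_cancel₀ ht3
    linear_combination hsub
  have hnear : P =ᶠ[𝓝[>] 0] fun _ => -(2 / 3) := by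
    filter_upwards [Ioo_mem_nhdsGT hτ] with t ht
    exact hPconst t ht.1 ht.2
  have hP0 : P 0 = -(2 / 3) :=
    tendsto_nhds_unique ((hP 0).continuousAt.tendsto.mono_left nhdsWithin_le_nhds)
      (tendsto_const_nhds.congr' hnear.symm)
  have hP'0 : P' 0 = 0 :=
    (uniqueDiffWithinAt_Ioi (0 : ℝ)).eq_deriv _ (hP 0).hasDerivWithinAt
      ((hasDerivWithinAt_const _ _ _).congr_of_eventuallyEq hnear hP0)
  have hlin : HasDerivAt (fun θ => G (0, θ)) (fderiv ℝ G (0, 0) (0, 1)) 0 :=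
    (hGd (0, 0)).hasFDerivAt.comp_hasDerivAt (0 : ℝ)
      ((hasDerivAt_const (0 : ℝ) (0 : ℝ)).prodMk (hasDerivAt_id (0 : ℝ)))
  constructor
  · have hval : P 0 = G (0, 0) * -(2 / 3) := by
      simp only [P, mul_zero, intervalIntegral.integral_const_mul, ne_eq, OfNat.ofNat_ne_zero,
        not_false_eq_true, zero_pow]
      rw [intervalIntegral.integral_sub (by simp) (by simp)]
      norm_num
    linarith
  · rw [hlin.deriv]
    have hscale : ∀ s : ℝ, fderiv ℝ G (0, 0) (0, s) * (s ^ 2 - 1) =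
        fderiv ℝ G (0, 0) (0, 1) * (s ^ 3 - s) := fun s => by
      have : ((0 : ℝ), s) = s • ((0 : ℝ), (1 : ℝ)) := by simp
      rw [this, map_smul, smul_eq_mul]
      ring
    have hval : P' 0 = fderiv ℝ G (0, 0) (0, 1) * -(1 / 4) := by
      simp only [P', mul_zero, ne_eq, OfNat.ofNat_ne_zero, not_false_eq_true, zero_pow, hscale,
        intervalIntegral.integral_const_mul]
      rw [intervalIntegral.integral_sub (by simp) (by simp)]
      norm_num
    linarith

/-- A smooth function with 1-jet `1` at the origin has a smooth local cube root with the same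
1-jet. -/
theorem exists_cube_root_of_one_jet {K : ℝ → ℝ} (hK : ContDiff ℝ (⊤ : ℕ∞) K) (hK0 : K 0 = 1)
    (hK'0 : deriv K 0 = 0) :
    ∃ L : ℝ → ℝ, ContDiff ℝ (⊤ : ℕ∞) L ∧ ∀ᶠ θ in 𝓝 0, K θ = (1 + θ ^ 2 * L θ) ^ 3 := by
  have hpos : IsOpen {θ | 0 < K θ} := isOpen_lt continuous_const hK.continuous
  have h0pos : (0 : ℝ) ∈ {θ | 0 < K θ} := by simp [hK0]
  obtain ⟨M, hM, hMK⟩ := exists_contDiff_eventuallyEq hpos h0pos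
    (f := fun θ => K θ ^ ((1 : ℝ) / 3))
    (hK.contDiffOn.rpow_const_of_ne fun θ hθ => ne_of_gt hθ)
  have hcube : ∀ᶠ θ in 𝓝 0, K θ = M θ ^ 3 := by
    filter_upwards [hMK, hpos.mem_nhds h0pos] with θ hθ hθpos
    rw [hθ, ← Real.rpow_natCast, ← Real.rpow_mul (le_of_lt hθpos)]
    norm_num
  have hM0 : M 0 = 1 := by simp [hMK.eq_of_nhds, hK0]
  have hM'0 : deriv M 0 = 0 := by
    have hd := ((hM.differentiable (by simp) 0).hasDerivAt.pow 3).deriv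
    have heq : deriv K 0 = deriv (M ^ 3) 0 := EventuallyEq.deriv_eq hcube
    rw [hd, hK'0, hM0] at heq
    norm_num at heq
    exact heq
  obtain ⟨N, hN, hN0, hMN⟩ := exists_contDiff_eq_add_mul hM
  obtain ⟨L, hL, -, hNL⟩ := exists_contDiff_eq_add_mul hN
  refine ⟨L, hL, ?_⟩
  filter_upwards [hcube] with θ hθ
  rw [hθ, hMN θ, hNL θ, hN0, hM'0, hM0]
  ring

/-- (Lemma 3.3 of the paper: cube root normalization on the central fiber.)
If `h` is smooth near `(0,0)` and `∫₀^{√x} h(x,θ)(θ² − x) dθ = −(2/3)x^{3/2}` for all small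
`x ≥ 0`, then there is a smooth function `L` near `0` such that `ψ₀(θ) = θ + θ³·L(θ)`
satisfies `∫₀^θ h(0,η) η² dη = ψ₀(θ)³/3` for all small `θ`. -/
theorem central_fiber_cube_root_normalization
    (W : Set (ℝ × ℝ)) (hW : IsOpen W) (h0W : ((0:ℝ), (0:ℝ)) ∈ W)
    (h : ℝ → ℝ → ℝ)
    (hsmooth : ContDiffOn ℝ (⊤ : ℕ∞) (fun p : ℝ × ℝ => h p.1 p.2) W)
    (δ : ℝ) (hδ : 0 < δ)
    (hnorm : ∀ x : ℝ, 0 ≤ x → x < δ →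
      (∫ θ in (0:ℝ)..(Real.sqrt x), h x θ * (θ ^ 2 - x)) = -(2/3) * x ^ ((3:ℝ)/2)) :
    ∃ (L : ℝ → ℝ) (ε : ℝ), 0 < ε ∧
      ContDiffOn ℝ (⊤ : ℕ∞) L (Set.Ioo (-ε) ε) ∧
      ∀ θ : ℝ, |θ| < ε →
        (∫ η in (0:ℝ)..θ, h 0 η * η ^ 2) = (θ + θ ^ 3 * L θ) ^ 3 / 3 := by
  obtain ⟨G, hG, hGh⟩ := exists_contDiff_eventuallyEq hW h0W hsmooth
  obtain ⟨r, hr, hball⟩ := Metric.eventually_nhds_iff_ball.1 hGh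
  have hG_eq : ∀ x θ : ℝ, |x| < r → |θ| < r → G (x, θ) = h x θ := fun x θ hx hθ =>
    hball (x, θ) (by simp [Prod.dist_eq, hx, hθ])
  obtain ⟨hG0, hG'0⟩ := one_jet_of_integral_sq_sub_eq hG
    (τ := min (min 1 r) δ) (by positivity) fun t ht htτ => by
      obtain ⟨⟨ht1, htr⟩, htδ⟩ : (t < 1 ∧ t < r) ∧ t < δ := by simpa using htτ
      have hsq : t ^ 2 < t := by nlinarith
      have hn := hnorm (t ^ 2) (by positivity) (by linarith)
      rw [Real.sqrt_sq ht.le, ← Real.rpow_natCast_mul ht.le] at hn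
      norm_num at hn
      rw [neg_mul, ← hn]
      refine intervalIntegral.integral_congr fun θ hθ => ?_
      rw [uIcc_of_le ht.le] at hθ
      rw [hG_eq (t ^ 2) θ (by rw [abs_of_nonneg (by positivity)]; linarith)
        (by rw [abs_of_nonneg hθ.1]; linarith [hθ.2])]
  have hf : ContDiff ℝ (⊤ : ℕ∞) fun θ => G (0, θ) := hG.comp (contDiff_const.prodMk contDiff_id)
  have hI := contDiff_integral_comp_mul_mul_pow hf 2
  have hI' := hasDerivAt_integral_comp_mul_mul_pow (contDiff_infty.1 hf 1) 2 0
  obtain ⟨L, hL, hcube⟩ := exists_cube_root_of_one_jet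
    (K := fun θ => 3 * ∫ s in (0 : ℝ)..1, G (0, s * θ) * s ^ 2)
    (contDiff_const.mul hI) (by simp [hG0]; norm_num)
    (by rw [(hI'.const_mul 3).deriv]; simp [hG'0])
  obtain ⟨ε, hε, hεL⟩ := Metric.eventually_nhds_iff.1 hcube
  refine ⟨L, min ε r, by positivity, hL.contDiffOn, fun θ hθ => ?_⟩
  obtain ⟨hθε, hθr⟩ := lt_min_iff.1 hθ
  have hroot := hεL (y := θ) (by simpa using hθε)
  have hfiber : ∫ η in (0 : ℝ)..θ, h 0 η * η ^ 2 = ∫ η in (0 : ℝ)..θ, G (0, η) * η ^ 2 := by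
    refine intervalIntegral.integral_congr fun η hη => ?_
    have hηθ : |η| ≤ |θ| := by simpa using abs_sub_left_of_mem_uIcc hη
    rw [hG_eq 0 η (by simpa using hr) (by linarith)]
  have hsub := intervalIntegral.mul_integral_comp_mul_right (a := 0) (b := 1)
    (f := fun η => G (0, η) * η ^ 2) (c := θ)
  have hscale : ∀ s : ℝ, G (0, s * θ) * (s * θ) ^ 2 = θ ^ 2 * (G (0, s * θ) * s ^ 2) :=
    fun s => by ring
  simp only [zero_mul, one_mul, hscale, intervalIntegral.integral_const_mul] at hsub
  rw [hfiber, ← hsub]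
  linear_combination θ ^ 3 / 3 * hroot
end
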